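/- arXiv:2412.12860 — 2 statements merged into one kernel-verified Lean document; each statement's English description precedes it below -/
import Mathlib

section
/- Let Δ be a d-dimensional normal pseudomanifold, 𝕜 a field, and let τ ⊆ σ be faces of Δ with H_d(Δ, cost_Δ(τ); 𝕜) ≠ 0. Then the natural map ι*: H_d(Δ, cost_Δ(τ); 𝕜) → H_d(Δ, cost_Δ(σ); 𝕜) induced by the inclusion cost_Δ(τ) ⊆ cost_Δ(σ) is an isomorphism; in particular H_d(Δ, cost_Δ(σ); 𝕜) ≅ H_d(Δ, cost_Δ(τ); 𝕜) ≅ 𝕜. -/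
/-! # Preliminaries

Self-contained definitions: simplicial complexes, simplicial homology, Stanley–Reisner rings,
canonical modules, canonical traces, and the various Gorenstein-type conditions. -/

open CategoryTheory

/-- An abstract simplicial complex on the vertex set `Fin n` (the empty set is a face). -/
structure SC (n : ℕ) where
  faces : Finset (Finset (Fin n))
  empty_mem : ∅ ∈ faces
  down_closed : ∀ {σ τ : Finset (Fin n)}, σ ∈ faces → τ ⊆ σ → τ ∈ faces

namespace SC

variable {n : ℕ} (Δ : SC n)

/-- The dimension of a simplicial complex, as an integer (the complex `{∅}` has
dimension `-1`). -/
def dim : ℤ := ((Δ.faces.sup Finset.card : ℕ) : ℤ) - 1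

/-- `v` is a vertex of `Δ`. -/
def IsVertex (v : Fin n) : Prop := {v} ∈ Δ.faces

/-- A facet is a face which is maximal by inclusion. -/
def IsFacet (σ : Finset (Fin n)) : Prop :=
  σ ∈ Δ.faces ∧ ∀ τ ∈ Δ.faces, σ ⊆ τ → σ = τ

/-- A cone point is a vertex contained in every facet. -/
def IsConePoint (v : Fin n) : Prop :=
  Δ.IsVertex v ∧ ∀ σ, Δ.IsFacet σ → v ∈ σ

/-- A simplicial complex is connected if it has a vertex and any two vertices are joined
by a path of edges. -/
def Connected : Prop :=
  (∃ v, Δ.IsVertex v) ∧ ∀ u v, Δ.IsVertex u → Δ.IsVertex v →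
    Relation.ReflTransGen (fun a b => ({a, b} : Finset (Fin n)) ∈ Δ.faces) u v

/-- A simplicial complex is strongly connected if any two facets are joined by a chain of
facets in which consecutive facets intersect in a face of dimension `dim Δ - 1`. -/
def StronglyConnected : Prop :=
  ∀ σ τ, Δ.IsFacet σ → Δ.IsFacet τ →
    Relation.ReflTransGen
      (fun α β => Δ.IsFacet α ∧ Δ.IsFacet β ∧ ((α ∩ β).card : ℤ) - 1 = Δ.dim - 1) σ τ

/-- A pseudomanifold: strongly connected, and every face of dimension `dim Δ - 1` is
contained in exactly two facets. -/
def IsPseudomanifold : Prop :=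
  Δ.StronglyConnected ∧
    ∀ τ ∈ Δ.faces, (τ.card : ℤ) - 1 = Δ.dim - 1 →
      {σ : Finset (Fin n) | Δ.IsFacet σ ∧ τ ⊆ σ}.ncard = 2

/-- The link of a face `σ` of `Δ`. -/
def link (σ : Finset (Fin n)) (hσ : σ ∈ Δ.faces) : SC n where
  faces := Δ.faces.filter fun τ => τ ∩ σ = ∅ ∧ τ ∪ σ ∈ Δ.faces
  empty_mem := by
    simp only [Finset.mem_filter]
    exact ⟨Δ.empty_mem, by simp, by simpa using hσ⟩
  down_closed := by
    intro σ' τ' h hsub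
    simp only [Finset.mem_filter] at h ⊢
    refine ⟨Δ.down_closed h.1 hsub, ?_, ?_⟩
    · have := h.2.1
      rw [Finset.eq_empty_iff_forall_notMem] at this ⊢
      intro x hx
      exact this x (Finset.mem_inter.mpr
        ⟨hsub (Finset.mem_inter.mp hx).1, (Finset.mem_inter.mp hx).2⟩)
    · exact Δ.down_closed h.2.2 (Finset.union_subset_union hsub (le_refl σ))

/-- A complex is normal if the link of every face of dimension `≤ dim Δ - 2` is connected. -/
def Normal : Prop :=
  ∀ σ (hσ : σ ∈ Δ.faces), (σ.card : ℤ) - 1 ≤ Δ.dim - 2 → (Δ.link σ hσ).Connected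

/-! ## Simplicial homology -/

/-- Faces of `Δ` of cardinality `c` containing the face `σ`.  These index a basis of the
`c`-th chain group of the pair `(Δ, cost_Δ σ)` (for `σ = ∅` this is the augmented
(reduced) chain complex of `Δ`, since the empty face is included in chain degree `0`). -/
def RFace (σ : Finset (Fin n)) (c : ℕ) : Type :=
  {τ : Finset (Fin n) // τ ∈ Δ.faces ∧ σ ⊆ τ ∧ τ.card = c}

instance (σ : Finset (Fin n)) (c : ℕ) : Fintype (Δ.RFace σ c) :=
  inferInstanceAs (Fintype {τ : Finset (Fin n) // τ ∈ Δ.faces ∧ σ ⊆ τ ∧ τ.card = c})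

instance (σ : Finset (Fin n)) (c : ℕ) : DecidableEq (Δ.RFace σ c) :=
  inferInstanceAs (DecidableEq {τ : Finset (Fin n) // τ ∈ Δ.faces ∧ σ ⊆ τ ∧ τ.card = c})

variable (R : Type) [CommRing R]

/-- Chains of the pair `(Δ, cost_Δ σ)` with coefficients in `R`. -/
abbrev relChain (σ : Finset (Fin n)) (c : ℕ) : Type := Δ.RFace σ c → R

/-- The matrix of the simplicial boundary map of the pair `(Δ, cost_Δ σ)`: the coefficient of
`ρ` in `∂ τ` is `(-1)^j` if `ρ` is obtained from `τ` by deleting its `(j+1)`-st vertex (the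
deleted vertex not belonging to `σ`), and `0` otherwise. -/
def relBMat (σ : Finset (Fin n)) (i : ℕ) :
    Matrix (Δ.RFace σ i) (Δ.RFace σ (i + 1)) R :=
  fun ρ τ => ∑ v ∈ τ.1, if v ∉ σ ∧ τ.1.erase v = ρ.1
    then (-1 : R) ^ ((τ.1.filter (fun w => w < v)).card) else 0

/-- The boundary map of the chain complex of the pair `(Δ, cost_Δ σ)`. -/
noncomputable def relBoundary (σ : Finset (Fin n)) (i : ℕ) :
    Δ.relChain R σ (i + 1) →ₗ[R] Δ.relChain R σ i :=
  (Δ.relBMat R σ i).mulVecLin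

/-- The relative simplicial homology `H_d(Δ, cost_Δ σ; R)` (`d ≥ 0`). -/
noncomputable def relHomology (σ : Finset (Fin n)) (d : ℕ) : Type :=
  LinearMap.ker (Δ.relBoundary R σ d) ⧸
    Submodule.comap (LinearMap.ker (Δ.relBoundary R σ d)).subtype
      (LinearMap.range (Δ.relBoundary R σ (d + 1)))

noncomputable instance (σ : Finset (Fin n)) (d : ℕ) : AddCommGroup (Δ.relHomology R σ d) :=
  inferInstanceAs (AddCommGroup (LinearMap.ker (Δ.relBoundary R σ d) ⧸
    Submodule.comap (LinearMap.ker (Δ.relBoundary R σ d)).subtype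
      (LinearMap.range (Δ.relBoundary R σ (d + 1)))))

noncomputable instance (σ : Finset (Fin n)) (d : ℕ) : Module R (Δ.relHomology R σ d) :=
  inferInstanceAs (Module R (LinearMap.ker (Δ.relBoundary R σ d) ⧸
    Submodule.comap (LinearMap.ker (Δ.relBoundary R σ d)).subtype
      (LinearMap.range (Δ.relBoundary R σ (d + 1)))))

/-- Reduced simplicial homology `H̃_d(Δ; R)` for `d ≥ 0`: the homology of the augmented chain
complex, i.e. of the pair `(Δ, cost_Δ ∅)`. -/
noncomputable abbrev reducedHomology (d : ℕ) : Type := Δ.relHomology R ∅ d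

/-- Reduced simplicial homology in degree `-1`. -/
noncomputable def reducedHomologyNeg : Type :=
  (⊤ : Submodule R (Δ.relChain R ∅ 0)) ⧸
    Submodule.comap (⊤ : Submodule R (Δ.relChain R ∅ 0)).subtype
      (LinearMap.range (Δ.relBoundary R ∅ 0))

noncomputable instance : AddCommGroup (Δ.reducedHomologyNeg R) :=
  inferInstanceAs (AddCommGroup ((⊤ : Submodule R (Δ.relChain R ∅ 0)) ⧸
    Submodule.comap (⊤ : Submodule R (Δ.relChain R ∅ 0)).subtype
      (LinearMap.range (Δ.relBoundary R ∅ 0))))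

noncomputable instance : Module R (Δ.reducedHomologyNeg R) :=
  inferInstanceAs (Module R ((⊤ : Submodule R (Δ.relChain R ∅ 0)) ⧸
    Submodule.comap (⊤ : Submodule R (Δ.relChain R ∅ 0)).subtype
      (LinearMap.range (Δ.relBoundary R ∅ 0))))

/-- Cycles of the non-augmented chain complex of `Δ` in dimension `d` (for `d = 0` every
`0`-chain is a cycle). -/
noncomputable def cyclesUnred (d : ℕ) : Submodule R (Δ.relChain R ∅ (d + 1)) :=
  if d = 0 then ⊤ else LinearMap.ker (Δ.relBoundary R ∅ d)

/-- (Unreduced) simplicial homology `H_d(Δ; R)`. -/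
noncomputable def homologyUnred (d : ℕ) : Type :=
  Δ.cyclesUnred R d ⧸
    Submodule.comap (Δ.cyclesUnred R d).subtype (LinearMap.range (Δ.relBoundary R ∅ (d + 1)))

noncomputable instance (d : ℕ) : AddCommGroup (Δ.homologyUnred R d) :=
  inferInstanceAs (AddCommGroup (Δ.cyclesUnred R d ⧸
    Submodule.comap (Δ.cyclesUnred R d).subtype (LinearMap.range (Δ.relBoundary R ∅ (d + 1)))))

noncomputable instance (d : ℕ) : Module R (Δ.homologyUnred R d) :=
  inferInstanceAs (Module R (Δ.cyclesUnred R d ⧸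
    Submodule.comap (Δ.cyclesUnred R d).subtype (LinearMap.range (Δ.relBoundary R ∅ (d + 1)))))

/-- `Δ` is `R`-orientable if `H_d(Δ; R) ≠ 0`, where `d = dim Δ`. -/
def Orientable : Prop :=
  ∃ d : ℕ, Δ.dim = (d : ℤ) ∧ Nontrivial (Δ.homologyUnred R d)

/-- A `k`-homology sphere condition for a single complex `Γ`:
`H̃_i(Γ; k) = k` for `i = dim Γ` and `0` otherwise. -/
def HomologySphereCond (Γ : SC n) : Prop :=
  (∀ i : ℕ, ((i : ℤ) = Γ.dim → Nonempty ((Γ.reducedHomology R i) ≃ₗ[R] R)) ∧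
    ((i : ℤ) ≠ Γ.dim → Subsingleton (Γ.reducedHomology R i))) ∧
  ((-1 : ℤ) = Γ.dim → Nonempty ((Γ.reducedHomologyNeg R) ≃ₗ[R] R)) ∧
  ((-1 : ℤ) ≠ Γ.dim → Subsingleton (Γ.reducedHomologyNeg R))

/-- `Δ` is a `k`-homology manifold: it is connected and the link of every nonempty face has
the reduced homology of a sphere of its dimension. -/
def IsHomologyManifold : Prop :=
  Δ.Connected ∧ ∀ σ (hσ : σ ∈ Δ.faces), σ ≠ ∅ → HomologySphereCond R (Δ.link σ hσ)

/-- `Δ` is isomorphic to the disjoint union of `m` vertices. -/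
def IsDisjointVertices (m : ℕ) : Prop :=
  ∃ v : Fin m → Fin n, Function.Injective v ∧
    ∀ σ : Finset (Fin n), σ ∈ Δ.faces ↔ (σ = ∅ ∨ ∃ i, σ = {v i})

/-- `Δ` is isomorphic to a path of length `m` (with `m` edges and `m+1` vertices). -/
def IsPathComplex (m : ℕ) : Prop :=
  ∃ v : Fin (m + 1) → Fin n, Function.Injective v ∧
    ∀ σ : Finset (Fin n), σ ∈ Δ.faces ↔
      (σ = ∅ ∨ (∃ i, σ = {v i}) ∨ ∃ i : Fin m, σ = {v i.castSucc, v i.succ})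

end SC

/-! ## Commutative algebra -/

/-- The `i`-th Ext module `Ext^i_R(M, N)` of two `R`-modules, as an object of `ModuleCat R`. -/
noncomputable def extMod (R : Type) [CommRing R] (M N : Type) [AddCommGroup M] [Module R M]
    [AddCommGroup N] [Module R N] (i : ℕ) : ModuleCat R :=
  ((Ext R (ModuleCat R) i).obj (Opposite.op (ModuleCat.of R M))).obj (ModuleCat.of R N)

/-- The trace ideal of an `R`-module `M`: the sum of the images of all `R`-linear maps
`M → R`. -/
noncomputable def traceIdeal (R : Type) [CommRing R] (M : Type) [AddCommGroup M] [Module R M] :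
    Ideal R :=
  ⨆ f : M →ₗ[R] R, LinearMap.range f

/-- A Noetherian ring `R` with a distinguished maximal ideal `𝔪` (a local ring, or a graded
ring with its graded maximal ideal) is Cohen--Macaulay when `depth = dim`, i.e. (by the
Ext-characterisation of depth) `Ext^i_R(R/𝔪, R) = 0` for all `i < dim R`. -/
def IsCohenMacaulayAt (R : Type) [CommRing R] (𝔪 : Ideal R) : Prop :=
  IsNoetherianRing R ∧
    ∀ i : ℕ, (i : WithBot (WithTop ℕ)) < ringKrullDim R → Subsingleton (extMod R (R ⧸ 𝔪) R i)

/-- A Noetherian ring `R` with a distinguished maximal ideal `𝔪` (a local ring, or a graded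
ring with its graded maximal ideal) is Gorenstein when `Ext^i_R(R/𝔪, R)` vanishes for
`i ≠ dim R` and is isomorphic to `R/𝔪` for `i = dim R`. -/
def IsGorensteinAt (R : Type) [CommRing R] (𝔪 : Ideal R) : Prop :=
  IsNoetherianRing R ∧
    ∀ i : ℕ, ((i : WithBot (WithTop ℕ)) = ringKrullDim R →
        Nonempty ((extMod R (R ⧸ 𝔪) R i) ≃ₗ[R] (R ⧸ 𝔪))) ∧
      ((i : WithBot (WithTop ℕ)) ≠ ringKrullDim R → Subsingleton (extMod R (R ⧸ 𝔪) R i))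

/-- A Noetherian local ring is Gorenstein. -/
def IsGorensteinLocalRing (A : Type) [CommRing A] [IsLocalRing A] : Prop :=
  IsGorensteinAt A (IsLocalRing.maximalIdeal A)

section Graded

variable (k : Type) [Field k] {n : ℕ}

/-- An ideal of a polynomial ring is homogeneous (graded) if it contains all homogeneous
components of its elements. -/
def IsHomogIdeal (I : Ideal (MvPolynomial (Fin n) k)) : Prop :=
  ∀ p ∈ I, ∀ d : ℕ, MvPolynomial.homogeneousComponent d p ∈ I

/-- The graded (irrelevant) maximal ideal of `k[x_1,…,x_n]/I`, generated by the images of the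
variables. -/
noncomputable def quotMax (I : Ideal (MvPolynomial (Fin n) k)) :
    Ideal (MvPolynomial (Fin n) k ⧸ I) :=
  Ideal.span (Set.range fun i : Fin n => Ideal.Quotient.mk I (MvPolynomial.X i))

/-- The degree `j` component of the standard graded ring `k[x_1,…,x_n]/I`, as a
`k`-subspace. -/
noncomputable def quotGrade (I : Ideal (MvPolynomial (Fin n) k)) (j : ℕ) :
    Submodule k (MvPolynomial (Fin n) k ⧸ I) :=
  (MvPolynomial.homogeneousSubmodule (Fin n) k j).map (Ideal.Quotient.mkₐ k I).toLinearMap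

/-- The `ℤ^n`-graded component of `k[x_1,…,x_n]/I` of multidegree `a`: the `k`-line spanned by
the image of the monomial `x^a`. -/
noncomputable def quotMonomialGrade (I : Ideal (MvPolynomial (Fin n) k)) (a : Fin n → ℕ) :
    Submodule k (MvPolynomial (Fin n) k ⧸ I) :=
  Submodule.span k
    {Ideal.Quotient.mk I (MvPolynomial.monomial (Finsupp.equivFunOnFinite.symm a) (1 : k))}

/-- The standard graded ring `R = k[x_1,…,x_n]/I` is Gorenstein on the punctured spectrum if
`R_𝔭` is Gorenstein for every graded prime `𝔭` other than the graded maximal ideal. -/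
def GorensteinPunctured (I : Ideal (MvPolynomial (Fin n) k)) : Prop :=
  ∀ (𝔭 : Ideal (MvPolynomial (Fin n) k ⧸ I)) [𝔭.IsPrime],
    IsHomogIdeal k (𝔭.comap (Ideal.Quotient.mk I)) → 𝔭 ≠ quotMax k I →
      IsGorensteinLocalRing (Localization.AtPrime 𝔭)

/-- `ω` is a canonical module of the standard graded ring `R = k[x_1,…,x_n]/I`, `d = dim R`,
when `ω ≅ Ext^{n-d}_S(R, S)` for `S = k[x_1,…,x_n]` (by graded local duality this is, up to
shift, the Matlis dual of the top local cohomology module `H^d_𝔪(R)`). -/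
def IsCanonicalModuleQ (I : Ideal (MvPolynomial (Fin n) k)) (ω : Type) [AddCommGroup ω]
    [Module (MvPolynomial (Fin n) k ⧸ I) ω] : Prop :=
  Module.Finite (MvPolynomial (Fin n) k ⧸ I) ω ∧
    ∃ d : ℕ, ringKrullDim (MvPolynomial (Fin n) k ⧸ I) = (d : WithBot (WithTop ℕ)) ∧
      letI : Module (MvPolynomial (Fin n) k) ω := Module.compHom ω (Ideal.Quotient.mk I)
      Nonempty (ω ≃ₗ[MvPolynomial (Fin n) k]
        (extMod (MvPolynomial (Fin n) k) (MvPolynomial (Fin n) k ⧸ I)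
          (MvPolynomial (Fin n) k) (n - d)))

/-- A `ℤ`-grading on a module `ω` over `R = k[x_1,…,x_n]/I` compatible with the standard
grading of `R`. -/
def IsCompatibleGrading (I : Ideal (MvPolynomial (Fin n) k)) (ω : Type) [AddCommGroup ω]
    [Module (MvPolynomial (Fin n) k ⧸ I) ω] [Module k ω] (gr : ℤ → Submodule k ω) : Prop :=
  DirectSum.IsInternal gr ∧
    ∀ (i : ℕ) (j : ℤ) (r : MvPolynomial (Fin n) k ⧸ I) (m : ω),
      r ∈ quotGrade k I i → m ∈ gr j → r • m ∈ gr ((i : ℤ) + j)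

/-- The minimal number of generators of a module `M` over `R = k[…]/I` with graded maximal
ideal `𝔪`: the `k`-dimension of `M/𝔪M`. -/
noncomputable def muGen (R : Type) [CommRing R] [Algebra k R] (𝔪 : Ideal R) (M : Type)
    [AddCommGroup M] [Module R M] : ℕ :=
  letI : Module k (M ⧸ (𝔪 • (⊤ : Submodule R M))) :=
    Module.compHom (M ⧸ (𝔪 • (⊤ : Submodule R M))) (algebraMap k R)
  Module.finrank k (M ⧸ (𝔪 • (⊤ : Submodule R M)))

/-- The Hilbert--Samuel function `j ↦ dim_k M/𝔪^j M` of a module. -/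
noncomputable def hilbSam (R : Type) [CommRing R] [Algebra k R] (𝔪 : Ideal R) (M : Type)
    [AddCommGroup M] [Module R M] (j : ℕ) : ℕ :=
  letI : Module k (M ⧸ ((𝔪 ^ j) • (⊤ : Submodule R M))) :=
    Module.compHom (M ⧸ ((𝔪 ^ j) • (⊤ : Submodule R M))) (algebraMap k R)
  Module.finrank k (M ⧸ ((𝔪 ^ j) • (⊤ : Submodule R M)))

/-- `M` is an Ulrich module with respect to `𝔪`: its minimal number of generators `μ(M)`
equals its multiplicity `e(𝔪; M) = lim_j t!·dim_k(M/𝔪^j M)/j^t`, where `t = dim M`. -/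
def IsUlrich (R : Type) [CommRing R] [Algebra k R] (𝔪 : Ideal R) (M : Type) [AddCommGroup M]
    [Module R M] : Prop :=
  ∃ t : ℕ, ringKrullDim (R ⧸ Module.annihilator R M) = (t : WithBot (WithTop ℕ)) ∧
    Filter.Tendsto
      (fun j : ℕ => ((t.factorial : ℝ) * (hilbSam k R 𝔪 M j : ℝ)) / (j : ℝ) ^ t)
      Filter.atTop (nhds ((muGen k R 𝔪 M : ℝ)))

end Graded

section SR

variable (k : Type) [Field k] {n : ℕ}

/-- The Stanley--Reisner ideal of `Δ`: generated by the squarefree monomials supported on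
non-faces of `Δ`. -/
noncomputable def srIdeal (Δ : SC n) : Ideal (MvPolynomial (Fin n) k) :=
  Ideal.span {m | ∃ σ : Finset (Fin n), σ ∉ Δ.faces ∧ m = ∏ i ∈ σ, MvPolynomial.X i}

/-- The Stanley--Reisner ring `k[Δ]`. -/
abbrev SRRing (Δ : SC n) : Type := MvPolynomial (Fin n) k ⧸ srIdeal k Δ

/-- The graded maximal ideal of `k[Δ]`. -/
noncomputable abbrev srMax (Δ : SC n) : Ideal (SRRing k Δ) := quotMax k (srIdeal k Δ)

/-- The value at `j` of the Hilbert function of the (canonically graded) canonical module of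
`k[Δ]`, as computed by Gräbe's theorem:
`dim_k [ω]_j = Σ_{a ∈ ℕ^n, |a| = j} dim_k H_{dim Δ}(Δ, cost_Δ(supp a); k)`. -/
noncomputable def canonicalHilbert (Δ : SC n) (j : ℕ) : ℕ :=
  ∑ a ∈ (Fintype.piFinset fun _ : Fin n => Finset.range (j + 1)).filter
      (fun a => ∑ i, a i = j),
    Module.finrank k
      (Δ.relHomology k (Finset.univ.filter fun i => a i ≠ 0) (Δ.faces.sup Finset.card - 1))

/-- A `ℤ`-grading `gr` on a module `ω` over `k[Δ]` is the canonical grading of the canonical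
module if it is a compatible grading, is supported in nonnegative degrees, and its Hilbert
function is the one given by Gräbe's theorem. -/
def IsCanonicallyGraded (Δ : SC n) (ω : Type) [AddCommGroup ω] [Module (SRRing k Δ) ω]
    [Module k ω] (gr : ℤ → Submodule k ω) : Prop :=
  IsCompatibleGrading k (srIdeal k Δ) ω gr ∧ (∀ j : ℤ, j < 0 → gr j = ⊥) ∧
    ∀ j : ℕ, Module.finrank k (gr (j : ℤ)) = canonicalHilbert k Δ j

/-- A `ℤ^n`-grading `grN` on a module `ω` over `k[Δ]` (supported in `ℕ^n`) is the canonical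
multigrading of the canonical module if it is an internal direct sum, is compatible with the
`ℤ^n`-grading of `k[Δ]`, and its multigraded Hilbert function is the one given by Gräbe's
theorem: `dim_k [ω]_a = dim_k H_{dim Δ}(Δ, cost_Δ(supp a); k)`. -/
def IsCanonicallyMultiGraded (Δ : SC n) (ω : Type) [AddCommGroup ω] [Module (SRRing k Δ) ω]
    [Module k ω] (grN : (Fin n → ℕ) → Submodule k ω) : Prop :=
  DirectSum.IsInternal grN ∧
    (∀ (a b : Fin n → ℕ) (r : SRRing k Δ) (m : ω),
      r ∈ quotMonomialGrade k (srIdeal k Δ) a → m ∈ grN b → r • m ∈ grN (a + b)) ∧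
    ∀ a : Fin n → ℕ, Module.finrank k (grN a) =
      Module.finrank k
        (Δ.relHomology k (Finset.univ.filter fun i => a i ≠ 0) (Δ.faces.sup Finset.card - 1))

end SR

/-- The chain map `C_•(Δ, cost_Δ τ) → C_•(Δ, cost_Δ σ)` (for `τ ⊆ σ`) induced by the
inclusion `cost_Δ τ ⊆ cost_Δ σ`: basis faces not containing `σ` are sent to `0`. -/
def SC.relChainMap {n : ℕ} (Δ : SC n) (R : Type) [CommRing R] (τ σ : Finset (Fin n)) (c : ℕ) :
    Δ.relChain R τ c →ₗ[R] Δ.relChain R σ c :=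
  Matrix.mulVecLin (fun (β : Δ.RFace σ c) (α : Δ.RFace τ c) => if α.1 = β.1 then (1 : R) else 0)

set_option synthInstance.maxHeartbeats 1000000 in
/-- `R = k[x_1,…,x_n]/I` is almost Gorenstein with respect to a canonical module `ω` with
(canonical) grading `gr`: writing `a = a_R` for the `a`-invariant (so `-a` is the least degree
of `ω`), there is an injective degree-zero `R`-linear map `φ : R → ω(-a)` whose cokernel is
zero or an Ulrich module. -/
def IsAlmostGorenstein (k : Type) [Field k] {n : ℕ} (I : Ideal (MvPolynomial (Fin n) k))
    (ω : Type) [AddCommGroup ω] [Module (MvPolynomial (Fin n) k ⧸ I) ω] [Module k ω]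
    (gr : ℤ → Submodule k ω) : Prop :=
  ∃ a : ℤ, (gr (-a) ≠ ⊥ ∧ ∀ j : ℤ, j < -a → gr j = ⊥) ∧
    ∃ φ : (MvPolynomial (Fin n) k ⧸ I) →ₗ[MvPolynomial (Fin n) k ⧸ I] ω,
      Function.Injective φ ∧
      (∀ (i : ℕ) (r : MvPolynomial (Fin n) k ⧸ I),
        r ∈ quotGrade k I i → φ r ∈ gr ((i : ℤ) - a)) ∧
      (Subsingleton (ω ⧸ LinearMap.range φ) ∨
        IsUlrich k (MvPolynomial (Fin n) k ⧸ I) (quotMax k I) (ω ⧸ LinearMap.range φ))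

namespace SC

variable {n : ℕ} (Δ : SC n)

lemma aux_card_le {d : ℕ} (hd : Δ.dim = (d : ℤ)) {F : Finset (Fin n)} (hF : F ∈ Δ.faces) :
    F.card ≤ d + 1 := by
  have h1 : F.card ≤ Δ.faces.sup Finset.card := Finset.le_sup (f := Finset.card) hF
  unfold dim at hd
  omega

lemma aux_facet {d : ℕ} (hd : Δ.dim = (d : ℤ)) {F : Finset (Fin n)} (hF : F ∈ Δ.faces)
    (hc : F.card = d + 1) : Δ.IsFacet F := by
  refine ⟨hF, fun T hT hFT => Finset.eq_of_subset_of_card_le hFT ?_⟩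
  rw [hc]; exact Δ.aux_card_le hd hT

lemma aux_facet_card {d : ℕ} (hd : Δ.dim = (d : ℤ)) (hpm : Δ.IsPseudomanifold)
    {F : Finset (Fin n)} (hF : Δ.IsFacet F) : F.card = d + 1 := by
  obtain ⟨F0, hF0, hs⟩ := Finset.exists_mem_eq_sup Δ.faces ⟨∅, Δ.empty_mem⟩ Finset.card
  have hc0 : F0.card = d + 1 := by
    unfold dim at hd; omega
  have hle := Δ.aux_card_le hd hF.1
  have h := hpm.1 F0 F (Δ.aux_facet hd hF0 hc0) hF
  rcases Relation.ReflTransGen.cases_tail h with h | ⟨b, _, _, _, hbF⟩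
  · rw [h]; exact hc0
  · have h2 : (b ∩ F).card ≤ F.card := Finset.card_le_card Finset.inter_subset_right
    by_contra hne
    have hFd : F.card = d := by omega
    have h3 := hpm.2 F hF.1 (by rw [hd, hFd])
    have h4 : {S : Finset (Fin n) | Δ.IsFacet S ∧ F ⊆ S} = {F} := by
      ext S
      simp only [Set.mem_ofPred_eq, Set.mem_singleton_iff]
      constructor
      · rintro ⟨hS, hFS⟩
        exact (hF.2 S hS.1 hFS).symm
      · rintro rfl
        exact ⟨hF, subset_rfl⟩
    rw [h4, Set.ncard_singleton] at h3
    omega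

lemma aux_exists_facet {d : ℕ} (hd : Δ.dim = (d : ℤ)) (hpm : Δ.IsPseudomanifold)
    {T : Finset (Fin n)} (hT : T ∈ Δ.faces) : ∃ F ∈ Δ.faces, T ⊆ F ∧ F.card = d + 1 := by
  obtain ⟨F, hTF, hF⟩ := Δ.faces.exists_le_maximal hT
  refine ⟨F, hF.1, hTF, Δ.aux_facet_card hd hpm ⟨hF.1, fun S hS hFS => ?_⟩⟩
  exact le_antisymm hFS (hF.2 hS hFS)

/-- Propagation of a property along adjacent facets in the star of a face. -/
lemma aux_propagate {d : ℕ} (hd : Δ.dim = (d : ℤ)) (hpm : Δ.IsPseudomanifold)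
    (hnorm : Δ.Normal) (τ : Finset (Fin n)) (P : Finset (Fin n) → Prop)
    (hP : ∀ F ∈ Δ.faces, ∀ G ∈ Δ.faces, F.card = d + 1 → G.card = d + 1 → τ ⊆ F → τ ⊆ G →
      (F ∩ G).card = d → P F → P G) :
    ∀ (m : ℕ) (T : Finset (Fin n)), T ∈ Δ.faces → τ ⊆ T → T.card + m = d + 1 →
      ∀ F ∈ Δ.faces, ∀ G ∈ Δ.faces, F.card = d + 1 → G.card = d + 1 → T ⊆ F → T ⊆ G →
        P F → P G := by
  intro m
  induction m with
  | zero =>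
    intro T hT _ hm F hF G hG hFc hGc hTF hTG h
    have h1 := Finset.eq_of_subset_of_card_le hTF (by omega)
    have h2 := Finset.eq_of_subset_of_card_le hTG (by omega)
    rw [← h2, h1]; exact h
  | succ m ih =>
    intro T hT hτT hm F hF G hG hFc hGc hTF hTG h
    by_cases hFG : F = G
    · rw [← hFG]; exact h
    rcases Nat.eq_zero_or_pos m with hm0 | hm0
    · refine hP F hF G hG hFc hGc (hτT.trans hTF) (hτT.trans hTG) ?_ h
      have h1 : T.card ≤ (F ∩ G).card := Finset.card_le_card (Finset.subset_inter hTF hTG)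
      have h2 : (F ∩ G).card < F.card := by
        refine Finset.card_lt_card ⟨Finset.inter_subset_left, fun hh => hFG ?_⟩
        exact Finset.eq_of_subset_of_card_le (hh.trans Finset.inter_subset_right) (by omega)
      omega
    · have hcon := hnorm T hT (by rw [hd]; omega)
      obtain ⟨u, huF, huT⟩ := Finset.exists_mem_notMem_of_card_lt_card (s := T) (t := F) (by omega)
      obtain ⟨v, hvG, hvT⟩ := Finset.exists_mem_notMem_of_card_lt_card (s := T) (t := G) (by omega)
      have hvert : ∀ w S, S ∈ Δ.faces → T ⊆ S → w ∈ S → w ∉ T → (Δ.link T hT).IsVertex w := by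
        intro w S hS hTS hwS hwT
        simp only [IsVertex, link, Finset.mem_filter]
        refine ⟨Δ.down_closed hS (by simpa using hwS), Finset.singleton_inter_of_notMem hwT,
          Δ.down_closed hS (Finset.union_subset (by simpa using hwS) hTS)⟩
      have hpath := hcon.2 u v (hvert u F hF hTF huF huT) (hvert v G hG hTG hvG hvT)
      -- one step inside the star of `insert c T`
      have step : ∀ c, c ∉ T → ∀ A ∈ Δ.faces, ∀ B ∈ Δ.faces, A.card = d + 1 → B.card = d + 1 →
          T ⊆ A → T ⊆ B → c ∈ A → c ∈ B → P A → P B := by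
        intro c hcT A hA B hB hAc hBc hTA hTB hcA hcB
        have hsA : insert c T ⊆ A := Finset.insert_subset hcA hTA
        have hsB : insert c T ⊆ B := Finset.insert_subset hcB hTB
        refine ih (insert c T) (Δ.down_closed hA hsA) (hτT.trans (Finset.subset_insert _ _)) ?_
          A hA B hB hAc hBc hsA hsB
        rw [Finset.card_insert_of_notMem hcT]; omega
      have key : ∀ w, Relation.ReflTransGen
          (fun a b => ({a, b} : Finset (Fin n)) ∈ (Δ.link T hT).faces) u w → w ∉ T →
          ∀ B ∈ Δ.faces, B.card = d + 1 → T ⊆ B → w ∈ B → P B := by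
        intro w hw
        induction hw with
        | refl =>
          intro hwT B hB hBc hTB hwB
          exact step u huT F hF B hB hFc hBc hTF hTB huF hwB h
        | @tail b c _ hbc ih2 =>
          intro hcT B hB hBc hTB hcB
          simp only [link, Finset.mem_filter] at hbc
          obtain ⟨_, hdis, hun⟩ := hbc
          have hbT : b ∉ T := fun hb => by
            have : b ∈ ({b, c} : Finset (Fin n)) ∩ T := by simp [hb]
            rw [hdis] at this; simp at this
          obtain ⟨H, hH, hsub, hHc⟩ := Δ.aux_exists_facet hd hpm hun
          have hTH : T ⊆ H := Finset.subset_union_right.trans hsub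
          have hbH : b ∈ H := hsub (by simp)
          have hcH : c ∈ H := hsub (by simp)
          exact step c hcT H hH B hB hHc hBc hTH hTB hcH hcB (ih2 hbT H hH hHc hTH hbH)
      exact key v hpath hvT G hG hGc hTG hvG

lemma aux_entry_ne (k : Type) [Field k] {d : ℕ} (τ : Finset (Fin n)) (ρ : Δ.RFace τ d)
    (G : Δ.RFace τ (d + 1)) (h : ρ.1 ⊆ G.1) : Δ.relBMat k τ d ρ G ≠ 0 := by
  obtain ⟨v, hvG, hvρ⟩ := Finset.exists_mem_notMem_of_card_lt_card (s := ρ.1) (t := G.1)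
    (by rw [ρ.2.2.2, G.2.2.2]; omega)
  have he : G.1.erase v = ρ.1 := by
    symm
    refine Finset.eq_of_subset_of_card_le (Finset.subset_erase.2 ⟨h, hvρ⟩) ?_
    rw [Finset.card_erase_of_mem hvG, ρ.2.2.2, G.2.2.2]; omega
  unfold relBMat
  rw [Finset.sum_eq_single v]
  · rw [if_pos ⟨fun hv => hvρ (ρ.2.2.1 hv), he⟩]
    exact pow_ne_zero _ (by simp)
  · intro w hw hwv
    rw [if_neg]
    rintro ⟨_, hw2⟩
    have : v ∈ G.1.erase w := Finset.mem_erase.2 ⟨hwv.symm, hvG⟩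
    rw [hw2] at this
    exact hvρ this
  · intro h; exact absurd hvG h

lemma aux_entry_zero (k : Type) [Field k] {d : ℕ} (τ : Finset (Fin n)) (ρ : Δ.RFace τ d)
    (G : Δ.RFace τ (d + 1)) (h : ¬ ρ.1 ⊆ G.1) : Δ.relBMat k τ d ρ G = 0 := by
  unfold relBMat
  refine Finset.sum_eq_zero fun v _ => if_neg ?_
  rintro ⟨_, h2⟩
  exact h (h2 ▸ Finset.erase_subset _ _)

lemma aux_adjacent (k : Type) [Field k] {d : ℕ} (hd : Δ.dim = (d : ℤ))
    (hpm : Δ.IsPseudomanifold) (τ : Finset (Fin n)) (x : Δ.relChain k τ (d + 1))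
    (hx : x ∈ LinearMap.ker (Δ.relBoundary k τ d)) (F G : Δ.RFace τ (d + 1))
    (hFG : (F.1 ∩ G.1).card = d) (hF : x F = 0) : x G = 0 := by
  have hρ : F.1 ∩ G.1 ∈ Δ.faces := Δ.down_closed F.2.1 Finset.inter_subset_left
  let ρ : Δ.RFace τ d := ⟨F.1 ∩ G.1, hρ, Finset.subset_inter F.2.2.1 G.2.2.1, hFG⟩
  have h1 : ∑ T, Δ.relBMat k τ d ρ T * x T = 0 := congrFun (LinearMap.mem_ker.1 hx) ρ
  have h2 := hpm.2 _ hρ (by rw [hd, hFG])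
  have hne : F.1 ≠ G.1 := by
    intro h
    rw [h, Finset.inter_self, G.2.2.2] at hFG
    omega
  have hS : ({F.1, G.1} : Set (Finset (Fin n))) =
      {S : Finset (Fin n) | Δ.IsFacet S ∧ F.1 ∩ G.1 ⊆ S} := by
    refine Set.eq_of_subset_of_ncard_le ?_ ?_ (Set.toFinite _)
    · rintro S (rfl | rfl)
      · exact ⟨Δ.aux_facet hd F.2.1 F.2.2.2, Finset.inter_subset_left⟩
      · exact ⟨Δ.aux_facet hd G.2.1 G.2.2.2, Finset.inter_subset_right⟩
    · rw [h2, Set.ncard_pair hne]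
  rw [Finset.sum_eq_single G] at h1
  · exact (mul_eq_zero.1 h1).resolve_left
      (Δ.aux_entry_ne k τ ρ G Finset.inter_subset_right)
  · intro T _ hTG
    by_cases hsub : ρ.1 ⊆ T.1
    · have hT : T.1 ∈ ({F.1, G.1} : Set (Finset (Fin n))) := by
        rw [hS]; exact ⟨Δ.aux_facet hd T.2.1 T.2.2.2, hsub⟩
      rcases hT with hT | hT
      · have : T = F := Subtype.ext hT
        rw [this, hF, mul_zero]
      · exact absurd (Subtype.ext hT) hTG
    · rw [Δ.aux_entry_zero k τ ρ T hsub, zero_mul]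
  · intro h; exact absurd (Finset.mem_univ _) h

lemma aux_cycle_zero (k : Type) [Field k] {d : ℕ} (hd : Δ.dim = (d : ℤ))
    (hpm : Δ.IsPseudomanifold) (hnorm : Δ.Normal) (τ : Finset (Fin n))
    (x : Δ.relChain k τ (d + 1)) (hx : x ∈ LinearMap.ker (Δ.relBoundary k τ d))
    (F : Δ.RFace τ (d + 1)) (hF : x F = 0) : x = 0 := by
  have hτ : τ ∈ Δ.faces := Δ.down_closed F.2.1 F.2.2.1
  have hle := Δ.aux_card_le hd hτ
  funext G
  refine Δ.aux_propagate hd hpm hnorm τ (fun S => ∀ h : S ∈ Δ.faces ∧ τ ⊆ S ∧ S.card = d + 1,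
    x ⟨S, h⟩ = 0) ?_ (d + 1 - τ.card) τ hτ subset_rfl (by omega) F.1 F.2.1 G.1 G.2.1 F.2.2.2
    G.2.2.2 F.2.2.1 G.2.2.1 (fun _ => hF) G.2
  intro A hA B hB hAc hBc hτA hτB hAB hPA hB'
  exact Δ.aux_adjacent k hd hpm τ x hx ⟨A, hA, hτA, hAc⟩ ⟨B, hB'⟩ hAB (hPA _)

lemma aux_range (k : Type) [Field k] {d : ℕ} (hd : Δ.dim = (d : ℤ)) (τ : Finset (Fin n))
    (x : Δ.relChain k τ (d + 1)) (hx : x ∈ LinearMap.range (Δ.relBoundary k τ (d + 1))) :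
    x = 0 := by
  obtain ⟨y, rfl⟩ := hx
  have : y = 0 := by
    funext T
    have h1 := Δ.aux_card_le hd T.2.1
    have h2 := T.2.2.2
    omega
  rw [this, map_zero]

/-- Evaluation of a top homology class at a facet is injective. -/
lemma aux_eval (k : Type) [Field k] {d : ℕ} (hd : Δ.dim = (d : ℤ))
    (hpm : Δ.IsPseudomanifold) (hnorm : Δ.Normal) (τ : Finset (Fin n))
    (F : Δ.RFace τ (d + 1)) :
    ∃ e : Δ.relHomology k τ d →ₗ[k] k, Function.Injective e ∧
      ∀ (x : Δ.relChain k τ (d + 1)) (hx : x ∈ LinearMap.ker (Δ.relBoundary k τ d)),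
        e (Submodule.Quotient.mk ⟨x, hx⟩) = x F := by
  let g : LinearMap.ker (Δ.relBoundary k τ d) →ₗ[k] k :=
    (LinearMap.proj F).comp (LinearMap.ker (Δ.relBoundary k τ d)).subtype
  let e : Δ.relHomology k τ d →ₗ[k] k := Submodule.liftQ
    (Submodule.comap (LinearMap.ker (Δ.relBoundary k τ d)).subtype
      (LinearMap.range (Δ.relBoundary k τ (d + 1)))) g (by
        intro x hx
        have h0 : x.1 = 0 := Δ.aux_range k hd τ x.1 hx
        show x.1 F = 0
        rw [h0]; rfl)
  have he : ∀ (x : Δ.relChain k τ (d + 1)) (hx : x ∈ LinearMap.ker (Δ.relBoundary k τ d)),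
        e (Submodule.Quotient.mk ⟨x, hx⟩) = x F := fun x hx => rfl
  refine ⟨e, ?_, he⟩
  rw [injective_iff_map_eq_zero]
  intro q hq
  obtain ⟨⟨x, hx⟩, rfl⟩ := Submodule.Quotient.mk_surjective _ q
  have h0 : x = 0 := Δ.aux_cycle_zero k hd hpm hnorm τ x hx F ((he x hx).symm.trans hq)
  subst h0
  rfl

lemma aux_chainMap (k : Type) [Field k] (τ σ : Finset (Fin n)) (c : ℕ)
    (x : Δ.relChain k τ c) (F : Δ.RFace σ c) (F' : Δ.RFace τ c) (h : F'.1 = F.1) :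
    Δ.relChainMap k τ σ c x F = x F' := by
  show ∑ T : Δ.RFace τ c, (if T.1 = F.1 then (1 : k) else 0) * x T = x F'
  rw [Finset.sum_eq_single F']
  · rw [if_pos h, one_mul]
  · intro T _ hT
    rw [if_neg (fun hh => hT (Subtype.ext (hh.trans h.symm))), zero_mul]
  · intro h; exact absurd (Finset.mem_univ _) h

end SC

set_option maxHeartbeats 1000000 in
set_option synthInstance.maxHeartbeats 1000000 in
/-- Let `Δ` be a `d`-dimensional normal pseudomanifold, `τ ⊆ σ` faces of
`Δ` with `H_d(Δ, cost_Δ τ; k) ≠ 0`.  Then the map induced on relative homology by the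
inclusion `cost_Δ τ ⊆ cost_Δ σ` is an isomorphism; in particular both relative homology
modules are isomorphic to `k`. -/
theorem relHomology_induced_map_bijective
    (k : Type) [Field k] {n : ℕ} (Δ : SC n) (d : ℕ) (hd : Δ.dim = (d : ℤ))
    (hpm : Δ.IsPseudomanifold) (hnorm : Δ.Normal)
    (τ σ : Finset (Fin n)) (hτ : τ ∈ Δ.faces) (hσ : σ ∈ Δ.faces) (hsub : τ ⊆ σ)
    (hne : Nontrivial (Δ.relHomology k τ d))
    (hker : ∀ x ∈ LinearMap.ker (Δ.relBoundary k τ d),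
      Δ.relChainMap k τ σ (d + 1) x ∈ LinearMap.ker (Δ.relBoundary k σ d))
    (f : Δ.relHomology k τ d →ₗ[k] Δ.relHomology k σ d)
    (hf : ∀ (x : Δ.relChain k τ (d + 1)) (hx : x ∈ LinearMap.ker (Δ.relBoundary k τ d)),
      f (Submodule.Quotient.mk ⟨x, hx⟩) =
        Submodule.Quotient.mk ⟨Δ.relChainMap k τ σ (d + 1) x, hker x hx⟩) :
    Function.Bijective f ∧ Nonempty ((Δ.relHomology k τ d) ≃ₗ[k] k) ∧
      Nonempty ((Δ.relHomology k σ d) ≃ₗ[k] k) := by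
  obtain ⟨F, hF, hσF, hFc⟩ := Δ.aux_exists_facet hd hpm hσ
  obtain ⟨e₁, he₁, h₁⟩ := Δ.aux_eval k hd hpm hnorm τ ⟨F, hF, hsub.trans hσF, hFc⟩
  obtain ⟨e₂, he₂, h₂⟩ := Δ.aux_eval k hd hpm hnorm σ ⟨F, hF, hσF, hFc⟩
  have hcomp : ∀ q, e₂ (f q) = e₁ q := by
    intro q
    obtain ⟨⟨x, hx⟩, rfl⟩ := Submodule.Quotient.mk_surjective _ q
    exact (congrArg e₂ (hf x hx)).trans ((h₂ _ _).trans
      ((Δ.aux_chainMap k τ σ (d + 1) x _ _ rfl).trans (h₁ x hx).symm))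
  have hs₁ : Function.Surjective e₁ := by
    obtain ⟨q, hq⟩ := exists_ne (0 : Δ.relHomology k τ d)
    have hne0 : e₁ q ≠ 0 := fun h => hq (he₁ (h.trans (map_zero e₁).symm))
    intro c
    refine ⟨(c * (e₁ q)⁻¹) • q, ?_⟩
    rw [map_smul, smul_eq_mul, inv_mul_cancel_right₀ hne0]
  have hs₂ : Function.Surjective e₂ := fun c => by
    obtain ⟨q, hq⟩ := hs₁ c
    exact ⟨f q, (hcomp q).trans hq⟩
  refine ⟨⟨fun a b hab => he₁ ?_, fun y => ?_⟩,
    ⟨LinearEquiv.ofBijective e₁ ⟨he₁, hs₁⟩⟩, ⟨LinearEquiv.ofBijective e₂ ⟨he₂, hs₂⟩⟩⟩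
  · rw [← hcomp, ← hcomp, hab]
  · obtain ⟨q, hq⟩ := hs₁ (e₂ y)
    exact ⟨q, he₂ ((hcomp q).trans hq)⟩
end

section
/- Let Δ be a d-dimensional normal pseudomanifold and R = 𝕜[Δ]. Then ω_R is generated by its components of (componentwise) minimal ℤ^n-degrees, i.e., ω_R^min = ω_R. In particular, if 𝕜 has characteristic 2 then ω_R = R·[ω_R]_0 ≅ R. Moreover, with respect to the ℤ-grading, if 𝕜 has characteristic ≠ 2 and Δ is a 𝕜-homology manifold, then: (1) Δ is orientable if and only if ω_R = R·[ω_R]_0 ≅ R; (2) Δ is not orientable if and only if ω_R = R·[ω_R]_1. -/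
/-! # Preliminaries

Self-contained definitions: simplicial complexes, simplicial homology, Stanley–Reisner rings,
canonical modules, canonical traces, and the various Gorenstein-type conditions. -/

open CategoryTheory

namespace CanonPf

section ExtBasics
variable {S : Type} [CommRing S]

/-- `Ext^i_S(M, S)` using the derived category version of `Ext`. -/
abbrev XE (S : Type) [CommRing S] (M : Type) [AddCommGroup M] [Module S M] (i : ℕ) : Type :=
  Abelian.Ext.{0} (ModuleCat.of S M) (ModuleCat.of S S) i

variable {M M₁ M₂ M₃ : Type} [AddCommGroup M] [Module S M] [AddCommGroup M₁] [Module S M₁]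
  [AddCommGroup M₂] [Module S M₂] [AddCommGroup M₃] [Module S M₃]

/-- contravariant functoriality -/
noncomputable def pull (f : M₁ →ₗ[S] M₂) (i : ℕ) : XE S M₂ i →ₗ[S] XE S M₁ i :=
  (Abelian.Ext.mk₀ (ModuleCat.ofHom f)).precompOfLinear S (ModuleCat.of S S) (zero_add i)

lemma pull_apply (f : M₁ →ₗ[S] M₂) (i : ℕ) (x : XE S M₂ i) :
    pull f i x = (Abelian.Ext.mk₀ (ModuleCat.ofHom f)).comp x (zero_add i) := rfl

lemma pull_id (i : ℕ) (x : XE S M i) : pull (LinearMap.id : M →ₗ[S] M) i x = x := by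
  rw [pull_apply]
  exact Abelian.Ext.mk₀_id_comp x

lemma pull_comp (f : M₁ →ₗ[S] M₂) (g : M₂ →ₗ[S] M₃) (i : ℕ) (x : XE S M₃ i) :
    pull (g ∘ₗ f) i x = pull f i (pull g i x) := by
  simp only [pull_apply]
  rw [ModuleCat.ofHom_comp]
  simp

lemma pull_smul (s : S) (f : M₁ →ₗ[S] M₂) (i : ℕ) (x : XE S M₂ i) :
    pull (s • f) i x = s • pull f i x := by
  simp only [pull_apply]
  rw [show ModuleCat.ofHom (s • f) = s • ModuleCat.ofHom f from rfl, Abelian.Ext.mk₀_smul]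
  simp

lemma pull_zero (i : ℕ) (x : XE S M₂ i) : pull (0 : M₁ →ₗ[S] M₂) i x = 0 := by
  have := pull_smul (0 : S) (0 : M₁ →ₗ[S] M₂) i x
  simpa using this

lemma les_shortExact (f : M₁ →ₗ[S] M₂) (g : M₂ →ₗ[S] M₃) (hf : Function.Injective f)
    (hg : Function.Surjective g) (h : Function.Exact f g) :
    (ModuleCat.shortComplexOfCompEqZero f g h.linearMap_comp_eq_zero).ShortExact where
  exact := ModuleCat.shortComplex_exact _ h
  mono_f := by
    rw [ModuleCat.mono_iff_injective]; exact hf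
  epi_g := by
    rw [ModuleCat.epi_iff_surjective]; exact hg

lemma les (f : M₁ →ₗ[S] M₂) (g : M₂ →ₗ[S] M₃) (hf : Function.Injective f)
    (hg : Function.Surjective g) (h : Function.Exact f g) :
    (∀ i, ∀ x : XE S M₂ i, pull f i x = 0 → ∃ y : XE S M₃ i, pull g i y = x) ∧
    (∀ x : XE S M₃ 0, pull g 0 x = 0 → x = 0) ∧
    ∃ δ : ∀ i, XE S M₁ i →ₗ[S] XE S M₃ (i+1),
      (∀ i, ∀ x : XE S M₂ i, δ i (pull f i x) = 0) ∧
      (∀ i, ∀ x : XE S M₁ i, δ i x = 0 → ∃ y, pull f i y = x) ∧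
      (∀ i, ∀ x : XE S M₃ (i+1), pull g (i+1) x = 0 → ∃ y, δ i y = x) := by
  have hS := les_shortExact f g hf hg h
  refine ⟨fun i x hx => ?_, fun x hx => ?_, fun i => hS.extClass.precompOfLinear S (ModuleCat.of S S)
    (add_comm 1 i), fun i x => ?_, fun i x hx => ?_, fun i x hx => ?_⟩
  · exact Abelian.Ext.contravariant_sequence_exact₂ hS _ x hx
  · have : Epi (ModuleCat.ofHom g) := hS.epi_g
    have := Abelian.Ext.precomp_mk₀_injective_of_epi (ModuleCat.of S S) (ModuleCat.ofHom g)
    apply this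
    rw [map_zero]
    exact hx
  · exact hS.extClass_comp_assoc x (h := add_comm 1 i)
  · exact Abelian.Ext.contravariant_sequence_exact₁ hS _ x (add_comm 1 i) hx
  · exact Abelian.Ext.contravariant_sequence_exact₃ hS _ x hx (add_comm 1 i)

end ExtBasics
end CanonPf

namespace CanonPf

section ExtCompare
variable {S : Type} [CommRing S]
variable {M : Type} [AddCommGroup M] [Module S M]

lemma smul_extMk {X Y : ModuleCat.{0} S} (P : ProjectiveResolution X) {i : ℕ}
    (f : P.complex.X i ⟶ Y) (m : ℕ) (hm : i + 1 = m) (hf : P.complex.d m i ≫ f = 0) (s : S) :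
    s • P.extMk f m hm hf = P.extMk (s • f) m hm (by simp [hf]) := by
  rw [Abelian.Ext.smul_eq_comp_mk₀, P.extMk_comp_mk₀]
  congr 1

/-- The derived functor `Ext` agrees with the derived category `Ext` (positive degrees). -/
lemma extMod_equiv (i : ℕ) : Nonempty (extMod S M S (i+1) ≃ₗ[S] XE S M (i+1)) := by
  let X := ModuleCat.of S M
  let Y := ModuleCat.of S S
  let P : ProjectiveResolution X := projectiveResolution X
  let K := P.complex.linearYonedaObj S Y
  have e1 : extMod S M S (i+1) ≃ₗ[S] K.homology (i+1) := (P.isoExt (R := S) (i+1) Y).toLinearEquiv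
  let ι : K.cycles (i+1) →ₗ[S] (P.complex.X (i+1) ⟶ Y) := (K.iCycles (i+1)).hom
  have hι : ∀ z : K.cycles (i+1), P.complex.d (i+2) (i+1) ≫ ι z = 0 := by
    intro z
    have h := K.iCycles_d (i+1) (i+2)
    have := congrArg (fun f => f.hom z) h
    exact this
  let α : K.cycles (i+1) →ₗ[S] XE S M (i+1) :=
    { toFun := fun z => P.extMk (ι z) (i+2) rfl (hι z)
      map_add' := by
        intro x y
        rw [P.add_extMk]
        congr 1
        exact map_add ι x y
      map_smul' := by
        intro s x
        rw [RingHom.id_apply, smul_extMk]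
        congr 1
        exact map_smul ι s x }
  have hα : Function.Surjective α := by
    intro x
    obtain ⟨f, hf, rfl⟩ := P.extMk_surjective x (i+2) rfl
    have : ∃ z : K.cycles (i+1), ι z = f := by
      let f' : K.X (i+1) := f
      let φ : ModuleCat.of S S ⟶ K.X (i+1) := ModuleCat.ofHom (LinearMap.toSpanSingleton S _ f')
      have hφ : φ ≫ K.d (i+1) (i+2) = 0 := by
        ext
        change K.d (i+1) (i+2) ((1 : S) • f') = 0
        rw [one_smul]
        exact hf
      refine ⟨K.liftCycles φ (i+2) (by simp) hφ (1 : S), ?_⟩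
      have h := K.liftCycles_i φ (i+2) (by simp) hφ
      have h2 := congrArg (fun f => f.hom (1 : S)) h
      refine Eq.trans h2 ?_
      change (1 : S) • f' = f
      rw [one_smul]
    obtain ⟨z, rfl⟩ := this
    exact ⟨z, rfl⟩
  let β : K.cycles (i+1) →ₗ[S] K.homology (i+1) := (K.homologyπ (i+1)).hom
  have hβ : Function.Surjective β := by
    rw [← ModuleCat.epi_iff_surjective]
    infer_instance
  have hk : LinearMap.ker α = LinearMap.ker β := by
    ext z
    rw [LinearMap.mem_ker, LinearMap.mem_ker]
    change P.extMk (ι z) (i+2) rfl (hι z) = 0 ↔ _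
    rw [P.extMk_eq_zero_iff _ _ _ _ i rfl]
    have hex : (ShortComplex.mk (K.toCycles i (i+1)) (K.homologyπ (i+1)) (by simp)).Exact :=
      ShortComplex.exact_of_g_is_cokernel _ (K.homologyIsCokernel i (i+1) (by simp))
    rw [ShortComplex.moduleCat_exact_iff] at hex
    have htc : ∀ g : K.X i, ι ((K.toCycles i (i+1)) g) = P.complex.d (i+1) i ≫ g := by
      intro g
      have h := K.toCycles_i i (i+1)
      exact congrArg (fun f => f.hom g) h
    have hinj : Function.Injective ι := by
      have : Mono (K.iCycles (i+1)) := inferInstance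
      rw [ModuleCat.mono_iff_injective] at this
      exact this
    constructor
    · rintro ⟨g, hg⟩
      have : z = (K.toCycles i (i+1)) g := by
        apply hinj
        exact hg.symm.trans (htc g).symm
      rw [this]
      have h := K.toCycles_comp_homologyπ i (i+1)
      exact congrArg (fun f => f.hom g) h
    · intro hz
      obtain ⟨g, hg⟩ := hex z hz
      refine ⟨g, ?_⟩
      rw [← htc]
      exact congrArg ι hg
  exact ⟨e1.trans ((β.quotKerEquivOfSurjective hβ).symm.trans
    ((Submodule.quotEquivOfEq _ _ hk.symm).trans (α.quotKerEquivOfSurjective hα)))⟩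

end ExtCompare
end CanonPf

namespace CanonPf

section ExtCI
variable {S : Type} [CommRing S]

/-- `Ext^i(M,S)` is concentrated in degree `r`, where it is isomorphic to `M`. -/
def EProp (M : Type) [AddCommGroup M] [Module S M] (r : ℕ) : Prop :=
  (∀ i, i ≠ r → ∀ x : XE S M i, x = 0) ∧ Nonempty (XE S M r ≃ₗ[S] M)

lemma xe_congr {M N : Type} [AddCommGroup M] [Module S M] [AddCommGroup N] [Module S N]
    (e : M ≃ₗ[S] N) (i : ℕ) : Nonempty (XE S M i ≃ₗ[S] XE S N i) :=
  ⟨LinearEquiv.ofLinearMap (pull (e.symm : N →ₗ[S] M) i) (pull (e : M →ₗ[S] N) i)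
    (by ext x; simp [← pull_comp, pull_id]) (by ext x; simp [← pull_comp, pull_id])⟩

lemma eprop_congr {M N : Type} [AddCommGroup M] [Module S M] [AddCommGroup N] [Module S N]
    (e : M ≃ₗ[S] N) {r : ℕ} (h : EProp (S := S) M r) : EProp (S := S) N r := by
  refine ⟨fun i hi x => ?_, ?_⟩
  · obtain ⟨f⟩ := xe_congr e i
    exact f.symm.injective (by rw [h.1 i hi (f.symm x), map_zero])
  · obtain ⟨f⟩ := xe_congr e r
    obtain ⟨g⟩ := h.2
    exact ⟨f.symm.trans (g.trans e)⟩

lemma eprop_self : EProp (S := S) S 0 := by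
  have hp : Projective (ModuleCat.of S S) :=
    (IsProjective.iff_projective (R := S) S).mp inferInstance
  refine ⟨fun i hi x => ?_, ?_⟩
  · obtain ⟨j, rfl⟩ := Nat.exists_eq_succ_of_ne_zero hi
    exact Abelian.Ext.eq_zero_of_projective _
  · exact ⟨(Abelian.Ext.linearEquiv₀ (R := S)).trans
      ((ModuleCat.homLinearEquiv (S := S)).trans (LinearMap.ringLmapEquivSelf S S S))⟩

lemma eprop_step {M N : Type} [AddCommGroup M] [Module S M] [AddCommGroup N] [Module S N]
    {r : ℕ} (h : EProp (S := S) M r) (f : S) (hf : ∀ m : M, f • m = 0 → m = 0)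
    (g : M →ₗ[S] N) (hg : Function.Surjective g)
    (hk : ∀ m : M, g m = 0 ↔ ∃ m', m = f • m') : EProp (S := S) N (r+1) := by
  let φ : M →ₗ[S] M := f • LinearMap.id
  have hφ : Function.Injective φ := by
    rw [← LinearMap.ker_eq_bot, LinearMap.ker_eq_bot']
    intro m hm; exact hf m hm
  have hex : Function.Exact φ g := by
    intro m
    rw [hk]
    constructor
    · rintro ⟨m', rfl⟩; exact ⟨m', rfl⟩
    · rintro ⟨m', rfl⟩; exact ⟨m', rfl⟩
  obtain ⟨h2, h0, δ, hδ1, hδ2, hδ3⟩ := les φ g hφ hg hex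
  obtain ⟨e⟩ := h.2
  have hpφ : ∀ i (x : XE S M i), pull φ i x = f • x := by
    intro i x
    rw [pull_smul, pull_id]
  have hinj : ∀ i (x : XE S M i), f • x = 0 → x = 0 := by
    intro i x hx
    by_cases hi : i = r
    · subst hi
      apply e.injective
      rw [map_zero]
      apply hf
      rw [← map_smul, hx, map_zero]
    · exact h.1 i hi x
  have hpg : ∀ i (x : XE S N i), pull g i x = 0 := by
    intro i x
    apply hinj
    rw [← hpφ, ← pull_comp, hex.linearMap_comp_eq_zero, pull_zero]
  have hsurj : ∀ i, Function.Surjective (δ i) := fun i x => hδ3 i x (hpg _ x)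
  refine ⟨fun i hi x => ?_, ?_⟩
  · cases i with
    | zero => exact h0 x (hpg _ x)
    | succ j =>
      obtain ⟨y, rfl⟩ := hsurj j x
      rw [h.1 j (by omega) y, map_zero]
  · have hker : (LinearMap.ker (δ r)).map (e : XE S M r →ₗ[S] M) = LinearMap.ker g := by
      ext m
      rw [LinearMap.mem_ker, hk, Submodule.mem_map]
      constructor
      · rintro ⟨x, hx, rfl⟩
        obtain ⟨y, rfl⟩ := hδ2 r x hx
        refine ⟨e y, ?_⟩
        rw [hpφ]; simp
      · rintro ⟨m', rfl⟩
        refine ⟨f • e.symm m', ?_, by simp⟩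
        rw [← hpφ]
        exact hδ1 r _
    exact ⟨((δ r).quotKerEquivOfSurjective (hsurj r)).symm.trans
      ((Submodule.Quotient.equiv _ _ e hker).trans (g.quotKerEquivOfSurjective hg))⟩

/-- version for quotient rings -/
lemma eprop_ideal_step {J J' : Ideal S} {r : ℕ} (h : EProp (S := S) (S ⧸ J) r) (f : S)
    (hf : ∀ p, f * p ∈ J → p ∈ J) (hJ : J' = J ⊔ Ideal.span {f}) :
    EProp (S := S) (S ⧸ J') (r+1) := by
  have hle : J ≤ J' := hJ ▸ le_sup_left
  refine eprop_step h f ?_ (Submodule.mapQ J J' LinearMap.id hle) ?_ ?_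
  · intro m
    obtain ⟨p, rfl⟩ := Submodule.Quotient.mk_surjective _ m
    rw [← Submodule.Quotient.mk_smul, Submodule.Quotient.mk_eq_zero,
      Submodule.Quotient.mk_eq_zero]
    exact hf p
  · intro m
    obtain ⟨p, rfl⟩ := Submodule.Quotient.mk_surjective _ m
    exact ⟨Submodule.Quotient.mk p, rfl⟩
  · intro m
    obtain ⟨p, rfl⟩ := Submodule.Quotient.mk_surjective _ m
    rw [Submodule.mapQ_apply, LinearMap.id_apply, Submodule.Quotient.mk_eq_zero, hJ,
      Submodule.mem_sup]
    constructor
    · rintro ⟨a, ha, b, hb, rfl⟩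
      obtain ⟨c, rfl⟩ := Ideal.mem_span_singleton'.mp hb
      refine ⟨Submodule.Quotient.mk c, ?_⟩
      rw [← Submodule.Quotient.mk_smul, Submodule.Quotient.eq]
      simpa [mul_comm] using ha
    · rintro ⟨m', hm⟩
      obtain ⟨c, rfl⟩ := Submodule.Quotient.mk_surjective _ m'
      rw [← Submodule.Quotient.mk_smul, Submodule.Quotient.eq] at hm
      exact ⟨_, hm, f * c, Ideal.mem_span_singleton'.mpr ⟨c, mul_comm _ _⟩, by simp⟩

lemma eprop_bot : EProp (S := S) (S ⧸ (⊥ : Ideal S)) 0 :=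
  eprop_congr (Submodule.quotEquivOfEqBot (⊥ : Ideal S) rfl).symm eprop_self

end ExtCI
end CanonPf

namespace CanonPf
open MvPolynomial

section Poly
variable {k : Type} [Field k] {n : ℕ}

/-- ideal generated by a set of variables -/
noncomputable def varIdeal (k : Type) [Field k] {n : ℕ} (A : Finset (Fin n)) :
    Ideal (MvPolynomial (Fin n) k) := Ideal.span (X '' (A : Set (Fin n)))

/-- the squarefree monomial of a set of variables -/
noncomputable def xm (k : Type) [Field k] {n : ℕ} (σ : Finset (Fin n)) :
    MvPolynomial (Fin n) k := ∏ i ∈ σ, X i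

/-- indicator exponent -/
noncomputable def ind {n : ℕ} (σ : Finset (Fin n)) : Fin n →₀ ℕ := ∑ i ∈ σ, Finsupp.single i 1

lemma ind_apply (σ : Finset (Fin n)) (i : Fin n) : ind σ i = if i ∈ σ then 1 else 0 := by
  simp [ind, Finsupp.finsetSum_apply, Finsupp.single_apply]

lemma ind_support (σ : Finset (Fin n)) : (ind σ).support = σ := by
  ext i; simp [ind_apply]

lemma xm_eq (σ : Finset (Fin n)) : xm k σ = monomial (ind σ) 1 := by
  rw [xm, ind, monomial_sum_one]; rfl

lemma mem_varIdeal (A : Finset (Fin n)) (p : MvPolynomial (Fin n) k) :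
    p ∈ varIdeal k A ↔ ∀ c ∈ p.support, ∃ i ∈ A, c i ≠ 0 := by
  rw [varIdeal, mem_ideal_span_X_image]; rfl

lemma support_monomial_mul {s c : Fin n →₀ ℕ} {p : MvPolynomial (Fin n) k} (hc : c ∈ p.support) :
    s + c ∈ (monomial s (1 : k) * p).support := by
  rw [mem_support_iff] at hc ⊢
  rw [coeff_monomial_mul]; simpa using hc

lemma of_support_monomial_mul {s e : Fin n →₀ ℕ} {p : MvPolynomial (Fin n) k}
    (hc : e ∈ (monomial s (1 : k) * p).support) : ∃ c ∈ p.support, e = s + c := by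
  rw [mem_support_iff, coeff_monomial_mul'] at hc
  split_ifs at hc with h
  · refine ⟨e - s, ?_, (add_tsub_cancel_of_le h).symm⟩
    rw [mem_support_iff]; simpa using hc
  · exact absurd rfl hc

lemma varIdeal_reg (A : Finset (Fin n)) (s : Fin n →₀ ℕ) (hs : ∀ i ∈ A, s i = 0)
    (p : MvPolynomial (Fin n) k) (hp : monomial s (1 : k) * p ∈ varIdeal k A) :
    p ∈ varIdeal k A := by
  rw [mem_varIdeal] at hp ⊢
  intro c hc
  obtain ⟨i, hi, h⟩ := hp _ (support_monomial_mul hc)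
  refine ⟨i, hi, ?_⟩
  simpa [hs i hi] using h

lemma eprop_var (A : Finset (Fin n)) :
    EProp (S := MvPolynomial (Fin n) k) (MvPolynomial (Fin n) k ⧸ varIdeal k A) A.card := by
  induction A using Finset.induction_on with
  | empty =>
    have : varIdeal k (∅ : Finset (Fin n)) = ⊥ := by simp [varIdeal]
    rw [this]
    exact eprop_bot
  | insert a A ha ih =>
    rw [Finset.card_insert_of_notMem ha]
    refine eprop_ideal_step ih (X a) ?_ ?_
    · intro p hp
      refine varIdeal_reg A (Finsupp.single a 1) ?_ p hp
      intro i hi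
      rw [Finsupp.single_eq_of_ne]
      rintro rfl; exact ha hi
    · rw [varIdeal, varIdeal, Finset.coe_insert, Set.image_insert_eq, Ideal.span_insert, sup_comm]

lemma eprop_var_mul (A : Finset (Fin n)) (u v : Fin n) (hu : u ∉ A) (hv : v ∉ A) :
    EProp (S := MvPolynomial (Fin n) k)
      (MvPolynomial (Fin n) k ⧸ (varIdeal k A ⊔ Ideal.span {X u * X v})) (A.card + 1) := by
  refine eprop_ideal_step (eprop_var A) _ ?_ rfl
  have key : ∀ a, a ∉ A → ∀ p, X a * p ∈ varIdeal k A → p ∈ varIdeal k A := by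
    intro a ha p hp
    refine varIdeal_reg A (Finsupp.single a 1) ?_ p hp
    intro i hi
    rw [Finsupp.single_eq_of_ne]
    rintro rfl; exact ha hi
  intro p hp
  rw [mul_assoc] at hp
  exact key v hv p (key u hu _ hp)

/-- Squarefree monomial ideal of a family of faces. -/
noncomputable def monI (k : Type) [Field k] {n : ℕ} (𝓕 : Finset (Finset (Fin n))) :
    Ideal (MvPolynomial (Fin n) k) :=
  Ideal.span {m | ∃ σ : Finset (Fin n), σ ∉ 𝓕 ∧ m = ∏ i ∈ σ, MvPolynomial.X i}

lemma srIdeal_eq (Δ : SC n) : srIdeal k Δ = monI k Δ.faces := rfl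

lemma mem_monI {𝓕 : Finset (Finset (Fin n))} (h𝓕 : ∀ σ τ, σ ∈ 𝓕 → τ ⊆ σ → τ ∈ 𝓕)
    (p : MvPolynomial (Fin n) k) : p ∈ monI k 𝓕 ↔ ∀ c ∈ p.support, c.support ∉ 𝓕 := by
  have : monI k 𝓕 = Ideal.span ((fun s => monomial s (1 : k)) '' (ind '' {σ | σ ∉ 𝓕})) := by
    rw [monI]
    congr 1
    ext m
    simp only [Set.mem_ofPred_eq, Set.mem_image, exists_exists_and_eq_and, ← xm_eq]
    constructor
    · rintro ⟨σ, h1, rfl⟩; exact ⟨σ, h1, rfl⟩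
    · rintro ⟨σ, h1, rfl⟩; exact ⟨σ, h1, rfl⟩
  rw [this, mem_ideal_span_monomial_image]
  refine forall₂_congr fun c hc => ?_
  constructor
  · rintro ⟨_, ⟨σ, hσ, rfl⟩, hle⟩ hmem
    refine hσ (h𝓕 _ _ hmem ?_)
    intro i hi
    rw [Finsupp.mem_support_iff]
    have := hle i
    rw [ind_apply, if_pos hi] at this
    omega
  · intro h
    refine ⟨_, ⟨c.support, h, rfl⟩, ?_⟩
    intro i
    rw [ind_apply]
    split_ifs with hi
    · rw [Finsupp.mem_support_iff] at hi; omega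
    · exact Nat.zero_le _

lemma monI_erase (𝓕 : Finset (Finset (Fin n))) (F : Finset (Fin n)) (_hF : F ∈ 𝓕) :
    monI k (𝓕.erase F) = monI k 𝓕 ⊔ Ideal.span {xm k F} := by
  rw [monI, monI, ← Ideal.span_union]
  congr 1
  ext m
  simp only [Set.mem_ofPred_eq, Set.mem_union, Set.mem_singleton_iff, Finset.mem_erase]
  constructor
  · rintro ⟨σ, h1, rfl⟩
    by_cases h : σ = F
    · right; rw [h]; rfl
    · left; exact ⟨σ, fun h' => h1 ⟨h, h'⟩, rfl⟩
  · rintro (⟨σ, h1, rfl⟩ | rfl)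
    · exact ⟨σ, fun h => h1 h.2, rfl⟩
    · exact ⟨F, by simp, rfl⟩

lemma xm_mul_mem_monI {𝓕 : Finset (Finset (Fin n))} (h𝓕 : ∀ σ τ, σ ∈ 𝓕 → τ ⊆ σ → τ ∈ 𝓕)
    {F : Finset (Fin n)} (hF : F ∈ 𝓕) (hmax : ∀ σ ∈ 𝓕, F ⊆ σ → F = σ)
    (p : MvPolynomial (Fin n) k) : xm k F * p ∈ monI k 𝓕 ↔ p ∈ varIdeal k Fᶜ := by
  rw [mem_monI h𝓕, mem_varIdeal, xm_eq]
  constructor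
  · intro h c hc
    by_contra hcon
    push Not at hcon
    refine h _ (support_monomial_mul hc) ?_
    convert hF using 1
    ext i
    rw [Finsupp.mem_support_iff, Finsupp.add_apply, ind_apply]
    by_cases hi : i ∈ F
    · simp [hi]
    · simp [hi, hcon i (by simpa using hi)]
  · intro h e he
    obtain ⟨c, hc, rfl⟩ := of_support_monomial_mul he
    obtain ⟨i, hi, hci⟩ := h c hc
    intro hmem
    have := hmax _ hmem (by
      intro j hj
      rw [Finsupp.mem_support_iff, Finsupp.add_apply, ind_apply, if_pos hj]; omega)
    rw [Finset.mem_compl] at hi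
    apply hi
    rw [this, Finsupp.mem_support_iff, Finsupp.add_apply]; omega

lemma xe_torsion (F : Finset (Fin n)) {i : ℕ} (hi : i = (Fᶜ).card)
    (z : XE (MvPolynomial (Fin n) k) (MvPolynomial (Fin n) k ⧸ varIdeal k Fᶜ) i)
    (h : xm k F • z = 0) : z = 0 := by
  subst hi
  obtain ⟨e⟩ := (eprop_var (k := k) Fᶜ).2
  apply e.injective
  rw [map_zero]
  have h2 : xm k F • e z = 0 := by rw [← map_smul, h, map_zero]
  obtain ⟨p, hp⟩ := Submodule.Quotient.mk_surjective _ (e z)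
  rw [← hp] at h2 ⊢
  rw [← Submodule.Quotient.mk_smul, Submodule.Quotient.mk_eq_zero, smul_eq_mul, xm_eq] at h2
  rw [Submodule.Quotient.mk_eq_zero]
  refine varIdeal_reg _ (ind F) ?_ p h2
  intro i hi
  rw [ind_apply, if_neg (by simpa using hi)]

lemma torsion_aux {r c : ℕ} (hn : n = r + (c + 1)) (N : ℕ) :
    ∀ (𝓕 : Finset (Finset (Fin n))), 𝓕.card = N → (∀ σ τ, σ ∈ 𝓕 → τ ⊆ σ → τ ∈ 𝓕) →
      (∀ σ ∈ 𝓕, σ.card ≤ r) →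
      ∀ m : XE (MvPolynomial (Fin n) k) (MvPolynomial (Fin n) k ⧸ monI k 𝓕) (c+1),
      (∀ F ∈ 𝓕, F.card = r → xm k F • m = 0) → m = 0 := by
  induction N with
  | zero =>
    intro 𝓕 hN _ _ m _
    rw [Finset.card_eq_zero] at hN
    subst hN
    have h1 : (1 : MvPolynomial (Fin n) k) ∈ monI k (∅ : Finset (Finset (Fin n))) :=
      Ideal.subset_span ⟨∅, by simp, by simp⟩
    have : (LinearMap.id : (MvPolynomial (Fin n) k ⧸ monI k (∅ : Finset (Finset (Fin n)))) →ₗ[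
        MvPolynomial (Fin n) k] _) = 0 := by
      ext
      simp only [LinearMap.id_comp, LinearMap.zero_comp, LinearMap.zero_apply]
      exact (Submodule.Quotient.mk_eq_zero _).mpr h1
    rw [← pull_id _ m, this, pull_zero]
  | succ N ih =>
    intro 𝓕 hN h𝓕 hcard m hm
    have hne : 𝓕.Nonempty := by rw [← Finset.card_pos]; omega
    obtain ⟨F, hF, hFmax⟩ := Finset.exists_max_image 𝓕 Finset.card hne
    have hmax : ∀ σ ∈ 𝓕, F ⊆ σ → F = σ := fun σ hσ hs =>
      Finset.eq_of_subset_of_card_le hs (hFmax σ hσ)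
    have hxm := fun p => xm_mul_mem_monI (k := k) h𝓕 hF hmax p
    let φ : (MvPolynomial (Fin n) k ⧸ varIdeal k Fᶜ) →ₗ[MvPolynomial (Fin n) k]
        (MvPolynomial (Fin n) k ⧸ monI k 𝓕) :=
      Submodule.mapQ _ _ (LinearMap.mulLeft _ (xm k F)) (fun p hp => (hxm p).mpr hp)
    have hφa : ∀ p, φ (Submodule.Quotient.mk p) = Submodule.Quotient.mk (xm k F * p) :=
      fun p => rfl
    have hle : monI k 𝓕 ≤ monI k (𝓕.erase F) := by
      rw [monI_erase 𝓕 F hF]; exact le_sup_left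
    let g : (MvPolynomial (Fin n) k ⧸ monI k 𝓕) →ₗ[MvPolynomial (Fin n) k]
        (MvPolynomial (Fin n) k ⧸ monI k (𝓕.erase F)) :=
      Submodule.mapQ _ _ LinearMap.id hle
    have hφ : Function.Injective φ := by
      rw [← LinearMap.ker_eq_bot, LinearMap.ker_eq_bot']
      intro x hx
      obtain ⟨p, rfl⟩ := Submodule.Quotient.mk_surjective _ x
      rw [hφa, Submodule.Quotient.mk_eq_zero] at hx
      rw [Submodule.Quotient.mk_eq_zero]
      exact (hxm p).mp hx
    have hg : Function.Surjective g := by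
      intro x
      obtain ⟨p, rfl⟩ := Submodule.Quotient.mk_surjective _ x
      exact ⟨Submodule.Quotient.mk p, rfl⟩
    have hex : Function.Exact φ g := by
      intro x
      obtain ⟨p, rfl⟩ := Submodule.Quotient.mk_surjective _ x
      have hga : g (Submodule.Quotient.mk p) = Submodule.Quotient.mk p := rfl
      rw [hga, Submodule.Quotient.mk_eq_zero,
        monI_erase 𝓕 F hF, Submodule.mem_sup]
      constructor
      · rintro ⟨a, ha, b, hb, rfl⟩
        obtain ⟨q, rfl⟩ := Ideal.mem_span_singleton'.mp hb
        refine ⟨Submodule.Quotient.mk q, ?_⟩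
        rw [hφa, Submodule.Quotient.eq]
        have : xm k F * q - (a + q * xm k F) = -a := by ring
        rw [this]; exact neg_mem ha
      · rintro ⟨y, hy⟩
        obtain ⟨q, rfl⟩ := Submodule.Quotient.mk_surjective _ y
        rw [hφa, Submodule.Quotient.eq] at hy
        refine ⟨p - xm k F * q, ?_, xm k F * q,
          Ideal.mem_span_singleton'.mpr ⟨q, mul_comm _ _⟩, by ring⟩
        rw [← neg_sub]; exact neg_mem hy
    obtain ⟨h2, -, δ, -, -, hδ3⟩ := les φ g hφ hg hex
    have hE := eprop_var (k := k) Fᶜ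
    have hFc : (Fᶜ).card = n - F.card := by rw [Finset.card_compl, Fintype.card_fin]
    have hFr := hcard F hF
    -- the restriction of `m` vanishes
    have hres : pull φ (c+1) m = 0 := by
      by_cases hFr' : F.card = r
      · have hc1 : c + 1 = (Fᶜ).card := by omega
        have h1 : xm k F • pull φ (c+1) m = 0 := by rw [← map_smul, hm F hF hFr', map_zero]
        exact xe_torsion F hc1 _ h1
      · exact hE.1 _ (by omega) _
    obtain ⟨m', rfl⟩ := h2 _ m hres
    have hginj : ∀ x, pull g (c+1) x = 0 → x = 0 := by
      intro x hx
      obtain ⟨y, rfl⟩ := hδ3 c x hx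
      rw [hE.1 c (by omega) y, map_zero]
    rw [ih (𝓕.erase F) (by rw [Finset.card_erase_of_mem hF]; omega) ?_ ?_ m' ?_, map_zero]
    · intro σ τ hσ hτ
      rw [Finset.mem_erase] at hσ ⊢
      refine ⟨?_, h𝓕 _ _ hσ.2 hτ⟩
      rintro rfl
      exact hσ.1 (hmax _ hσ.2 hτ).symm
    · intro σ hσ; exact hcard σ (Finset.mem_of_mem_erase hσ)
    · intro F' hF' hr
      apply hginj
      rw [map_smul]
      exact hm F' (Finset.mem_of_mem_erase hF') hr

end Poly
end CanonPf

namespace CanonPf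
open MvPolynomial

section Krull
variable {k : Type} [Field k] {n : ℕ}

lemma krull_lower (Δ : SC n) (F : Finset (Fin n)) (hF : F ∈ Δ.faces) :
    (F.card : WithBot ℕ∞) ≤ ringKrullDim (SRRing k Δ) := by
  classical
  let f : MvPolynomial (Fin n) k →ₐ[k] MvPolynomial F k :=
    aeval (fun i => if h : i ∈ F then X ⟨i, h⟩ else 0)
  have hf : ∀ p ∈ srIdeal k Δ, f.toRingHom p = 0 := by
    intro p hp
    have : srIdeal k Δ ≤ RingHom.ker f.toRingHom := by
      rw [srIdeal, Ideal.span_le]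
      rintro _ ⟨σ, hσ, rfl⟩
      have : ∃ i ∈ σ, i ∉ F := by
        by_contra h
        push Not at h
        exact hσ (Δ.down_closed hF h)
      obtain ⟨i, hi, hiF⟩ := this
      rw [SetLike.mem_coe, RingHom.mem_ker, map_prod]
      refine Finset.prod_eq_zero hi ?_
      change f (X i) = 0
      simp [f, hiF]
    exact this hp
  have hsurj : Function.Surjective (Ideal.Quotient.lift (srIdeal k Δ) f.toRingHom hf) := by
    apply Ideal.Quotient.lift_surjective_of_surjective
    have : Function.Surjective f := by
      rw [← AlgHom.range_eq_top, eq_top_iff, ← MvPolynomial.adjoin_range_X, Algebra.adjoin_le_iff]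
      rintro _ ⟨⟨i, hi⟩, rfl⟩
      exact ⟨X i, by simp [f, hi]⟩
    exact this
  have := ringKrullDim_le_of_surjective _ hsurj
  rw [MvPolynomial.ringKrullDim_of_isNoetherianRing, ringKrullDim_eq_zero_of_field] at this
  simpa using this

lemma krull_upper (Δ : SC n) (r : ℕ) (hr : ∀ σ ∈ Δ.faces, σ.card ≤ r) :
    ringKrullDim (SRRing k Δ) ≤ r := by
  classical
  refine iSup_le fun p => ?_
  let P := p.head.asIdeal
  have hP : P.IsPrime := p.head.2
  let σ : Finset (Fin n) := Finset.univ.filter fun i => Ideal.Quotient.mk (srIdeal k Δ) (X i) ∉ P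
  have hσ : σ ∈ Δ.faces := by
    by_contra h
    have h1 : Ideal.Quotient.mk (srIdeal k Δ) (∏ i ∈ σ, X i) ∈ P := by
      have h0 : (∏ i ∈ σ, X i : MvPolynomial (Fin n) k) ∈ srIdeal k Δ :=
        Ideal.subset_span ⟨σ, h, rfl⟩
      rw [Ideal.Quotient.eq_zero_iff_mem.mpr h0]
      exact zero_mem _
    rw [map_prod, hP.prod_mem_iff] at h1
    obtain ⟨i, hi, h2⟩ := h1
    exact (Finset.mem_filter.mp hi).2 h2
  have hlen : (p.length : WithBot ℕ∞) ≤ ringKrullDim (SRRing k Δ ⧸ P) := by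
    rw [ringKrullDim_quotient]
    refine le_trans ?_ (Order.LTSeries.length_le_krullDim
      (LTSeries.mk p.length (fun i => (⟨p i, ?_⟩ : PrimeSpectrum.zeroLocus (P : Set (SRRing k Δ)))) ?_))
    · exact le_rfl
    · exact LTSeries.head_le p i
    · intro i j hij
      exact p.strictMono hij
  let f : MvPolynomial σ k →ₐ[k] SRRing k Δ ⧸ P :=
    aeval (fun i => Ideal.Quotient.mk P (Ideal.Quotient.mk (srIdeal k Δ) (X i.1)))
  have hsurj : Function.Surjective f := by
    let g : MvPolynomial (Fin n) k →ₐ[k] SRRing k Δ ⧸ P :=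
      (Ideal.Quotient.mkₐ k P).comp (Ideal.Quotient.mkₐ k (srIdeal k Δ))
    have hg : Function.Surjective g :=
      (Ideal.Quotient.mk_surjective).comp (Ideal.Quotient.mk_surjective)
    rw [← AlgHom.range_eq_top, eq_top_iff, ← (AlgHom.range_eq_top g).mpr hg, ← Algebra.map_top,
      ← MvPolynomial.adjoin_range_X, AlgHom.map_adjoin, Algebra.adjoin_le_iff]
    rintro _ ⟨_, ⟨i, rfl⟩, rfl⟩
    by_cases hi : i ∈ σ
    · exact ⟨X ⟨i, hi⟩, by simp [f, g]⟩
    · refine ⟨0, ?_⟩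
      have : Ideal.Quotient.mk (srIdeal k Δ) (X i) ∈ P := by
        by_contra h
        exact hi (Finset.mem_filter.mpr ⟨Finset.mem_univ _, h⟩)
      change f 0 = Ideal.Quotient.mk P (Ideal.Quotient.mk (srIdeal k Δ) (X i))
      rw [map_zero, Ideal.Quotient.eq_zero_iff_mem.mpr this]
  have h2 : ringKrullDim (SRRing k Δ ⧸ P) ≤ ringKrullDim (MvPolynomial σ k) := by
    refine ringKrullDim_le_of_surjective f.toRingHom ?_
    exact hsurj
  rw [MvPolynomial.ringKrullDim_of_isNoetherianRing, ringKrullDim_eq_zero_of_field] at h2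
  refine hlen.trans (h2.trans ?_)
  simpa using hr σ hσ

end Krull
end CanonPf

namespace CanonPf
open MvPolynomial

section TC
variable {k : Type} [Field k] {n : ℕ}

lemma cyc_aux {S : Type} [CommRing S] (I I' : Ideal S) (h : I ≤ I') (a : S)
    (ha : ∀ p ∈ I', a * p ∈ I) {i : ℕ} (hE : EProp (S := S) (S ⧸ I') i) :
    ∃ w : XE S (S ⧸ I) i, ∀ m : XE S (S ⧸ I) i, ∃ s : S, a • m = s • w := by
  let g : (S ⧸ I) →ₗ[S] (S ⧸ I') := Submodule.mapQ _ _ LinearMap.id h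
  have hg : Function.Surjective g := by
    intro x
    obtain ⟨p, rfl⟩ := Submodule.Quotient.mk_surjective _ x
    exact ⟨Submodule.Quotient.mk p, rfl⟩
  have hex : Function.Exact (LinearMap.ker g).subtype g := by
    intro x
    simp
  obtain ⟨h1, -⟩ := les (LinearMap.ker g).subtype g (Submodule.subtype_injective _) hg hex
  have h0 : a • (LinearMap.ker g).subtype = 0 := by
    ext ⟨x, hx⟩
    obtain ⟨p, rfl⟩ := Submodule.Quotient.mk_surjective _ x
    have hp : p ∈ I' := by
      rw [LinearMap.mem_ker] at hx
      exact (Submodule.Quotient.mk_eq_zero _).mp hx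
    change a • (Submodule.Quotient.mk p : S ⧸ I) = 0
    rw [← Submodule.Quotient.mk_smul, Submodule.Quotient.mk_eq_zero]
    exact ha p hp
  obtain ⟨e⟩ := hE.2
  refine ⟨pull g i (e.symm (Submodule.Quotient.mk 1)), fun m => ?_⟩
  obtain ⟨y, hy⟩ := h1 i (a • m) (by rw [map_smul, ← pull_smul, h0, pull_zero])
  obtain ⟨s, hs⟩ := Submodule.Quotient.mk_surjective _ (e y)
  refine ⟨s, ?_⟩
  rw [← hy, ← map_smul, ← map_smul]
  congr 1
  apply e.injective
  rw [e.apply_symm_apply, ← hs, ← Submodule.Quotient.mk_smul, smul_eq_mul, mul_one]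

/-- Local structure around a ridge. -/
structure Ridge (Δ : SC n) (G : Finset (Fin n)) (u v : Fin n) : Prop where
  hu : u ∉ G
  hv : v ∉ G
  huv : u ≠ v
  fu : insert u G ∈ Δ.faces
  fv : insert v G ∈ Δ.faces
  nf : insert u (insert v G) ∉ Δ.faces
  only : ∀ j, j ∉ G → j ≠ u → j ≠ v → insert j G ∉ Δ.faces

lemma ridge_cyc {Δ : SC n} {G : Finset (Fin n)} {u v : Fin n} (hG : Ridge Δ G u v) {r c : ℕ}
    (hn : n = r + (c + 1)) (hr : G.card + 1 = r) :
    ∃ w : XE (MvPolynomial (Fin n) k) (SRRing k Δ) (c+1),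
      ∀ m : XE (MvPolynomial (Fin n) k) (SRRing k Δ) (c+1), ∃ s : MvPolynomial (Fin n) k,
        xm k G • m = s • w := by
  set A := (insert u (insert v G))ᶜ with hA
  have hcard : A.card + 1 = c + 1 := by
    rw [hA, Finset.card_compl, Fintype.card_fin, Finset.card_insert_of_notMem,
      Finset.card_insert_of_notMem hG.hv]
    · omega
    · simp [hG.hu, hG.huv]
  have hE := eprop_var_mul (k := k) A u v (by simp [hA]) (by simp [hA])
  rw [hcard] at hE
  refine cyc_aux (srIdeal k Δ) _ ?_ _ ?_ hE
  · rw [srIdeal, Ideal.span_le]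
    rintro _ ⟨σ, hσ, rfl⟩
    by_cases h : ∃ i ∈ σ, i ∈ A
    · obtain ⟨i, hi, hiA⟩ := h
      refine Ideal.mem_sup_left ?_
      rw [← Finset.mul_prod_erase σ _ hi]
      exact Ideal.mul_mem_right _ _ (Ideal.subset_span ⟨i, hiA, rfl⟩)
    · push Not at h
      have hs : ∀ i ∈ σ, i = u ∨ i = v ∨ i ∈ G := by
        intro i hi
        simpa [hA, imp_iff_not_or, or_assoc] using h i hi
      have hu : u ∈ σ := by
        by_contra hu
        refine hσ (Δ.down_closed hG.fv ?_)
        intro i hi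
        rcases hs i hi with rfl | h | h
        · exact absurd hi hu
        · simp [h]
        · simp [h]
      have hv : v ∈ σ.erase u := by
        rw [Finset.mem_erase]
        refine ⟨hG.huv.symm, ?_⟩
        by_contra hv
        refine hσ (Δ.down_closed hG.fu ?_)
        intro i hi
        rcases hs i hi with h | rfl | h
        · simp [h]
        · exact absurd hi hv
        · simp [h]
      refine Ideal.mem_sup_right ?_
      rw [← Finset.mul_prod_erase σ _ hu, ← Finset.mul_prod_erase _ _ hv, ← mul_assoc]
      exact Ideal.mul_mem_right _ _ (Ideal.subset_span rfl)
  · intro p hp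
    suffices h : varIdeal k A ⊔ Ideal.span {X u * X v} ≤
        Submodule.comap (LinearMap.mulLeft (MvPolynomial (Fin n) k) (xm k G)) (srIdeal k Δ) from h hp
    refine sup_le ?_ ?_
    · rw [varIdeal, Ideal.span_le]
      rintro _ ⟨i, hi, rfl⟩
      change xm k G * X i ∈ srIdeal k Δ
      have hi' : ¬ (i = u ∨ i = v ∨ i ∈ G) := by
        rintro (h | h | h) <;> simp [hA, h] at hi
      push Not at hi'
      have : xm k G * X i = ∏ j ∈ insert i G, X j := by
        rw [Finset.prod_insert hi'.2.2, mul_comm]; rfl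
      rw [this]
      exact Ideal.subset_span ⟨_, hG.only i hi'.2.2 hi'.1 hi'.2.1, rfl⟩
    · rw [Ideal.span_le, Set.singleton_subset_iff]
      change xm k G * (X u * X v) ∈ srIdeal k Δ
      have : xm k G * (X u * X v) = ∏ j ∈ insert u (insert v G), X j := by
        rw [Finset.prod_insert (by simp [hG.hu, hG.huv]), Finset.prod_insert hG.hv, xm]; ring
      rw [this]
      exact Ideal.subset_span ⟨_, hG.nf, rfl⟩

variable {ω : Type}

lemma canon_equiv (Δ : SC n) [AddCommGroup ω] [Module (SRRing k Δ) ω]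
    (hω : IsCanonicalModuleQ k (srIdeal k Δ) ω) {r c : ℕ} (hn : n = r + (c + 1))
    (hr : ∀ σ ∈ Δ.faces, σ.card ≤ r) (hF : ∃ F ∈ Δ.faces, F.card = r) :
    ∃ e : ω ≃+ XE (MvPolynomial (Fin n) k) (SRRing k Δ) (c+1),
      ∀ (s : MvPolynomial (Fin n) k) (m : ω),
        e (Ideal.Quotient.mk (srIdeal k Δ) s • m) = s • e m := by
  obtain ⟨-, d, hd, ⟨e⟩⟩ := hω
  obtain ⟨F, hF, hFr⟩ := hF
  have h1 := krull_lower (k := k) Δ F hF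
  have h2 := krull_upper (k := k) Δ r hr
  rw [hd] at h1 h2
  have h1' : F.card ≤ d := Nat.cast_le (α := WithBot ℕ∞).mp h1
  have h2' : d ≤ r := Nat.cast_le (α := WithBot ℕ∞).mp h2
  have h3 : n - d = c + 1 := by omega
  rw [h3] at e
  obtain ⟨e'⟩ := extMod_equiv (S := MvPolynomial (Fin n) k) (M := SRRing k Δ) c
  letI : Module (MvPolynomial (Fin n) k) ω := Module.compHom ω (Ideal.Quotient.mk (srIdeal k Δ))
  refine ⟨e.toAddEquiv.trans e'.toAddEquiv, fun s m => ?_⟩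
  change e' (e _) = s • e' (e m)
  rw [← map_smul]
  congr 1
  exact e.map_smul s m

lemma canon_T (Δ : SC n) [AddCommGroup ω] [Module (SRRing k Δ) ω]
    (hω : IsCanonicalModuleQ k (srIdeal k Δ) ω) {r c : ℕ} (hn : n = r + (c + 1))
    (hr : ∀ σ ∈ Δ.faces, σ.card ≤ r) (hF : ∃ F ∈ Δ.faces, F.card = r) (m : ω)
    (hm : ∀ F ∈ Δ.faces, F.card = r → Ideal.Quotient.mk (srIdeal k Δ) (xm k F) • m = 0) :
    m = 0 := by
  obtain ⟨e, he⟩ := canon_equiv Δ hω hn hr hF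
  apply e.injective
  rw [map_zero]
  refine torsion_aux hn _ Δ.faces rfl (fun σ τ => Δ.down_closed) hr (e m) ?_
  intro F hF hFr
  exact (he _ _).symm.trans ((congrArg e (hm F hF hFr)).trans (map_zero e))

lemma canon_C (Δ : SC n) [AddCommGroup ω] [Module (SRRing k Δ) ω]
    (hω : IsCanonicalModuleQ k (srIdeal k Δ) ω) {r c : ℕ} (hn : n = r + (c + 1))
    (hr : ∀ σ ∈ Δ.faces, σ.card ≤ r) (hF : ∃ F ∈ Δ.faces, F.card = r)
    {G : Finset (Fin n)} {u v : Fin n} (hG : Ridge Δ G u v) (hGr : G.card + 1 = r) :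
    ∃ w : ω, ∀ m : ω, ∃ s : MvPolynomial (Fin n) k,
      Ideal.Quotient.mk (srIdeal k Δ) (xm k G) • m = Ideal.Quotient.mk (srIdeal k Δ) s • w := by
  obtain ⟨e, he⟩ := canon_equiv Δ hω hn hr hF
  obtain ⟨w, hw⟩ := ridge_cyc (k := k) hG hn hGr
  refine ⟨e.symm w, fun m => ?_⟩
  obtain ⟨s, hs⟩ := hw (e m)
  refine ⟨s, ?_⟩
  apply e.injective
  rw [he, he, e.apply_symm_apply, hs]

end TC
end CanonPf

namespace CanonPf

section Comb
variable {n : ℕ} {Δ : SC n} {d : ℕ}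

lemma sup_eq (hd : Δ.dim = (d : ℤ)) : Δ.faces.sup Finset.card = d + 1 := by
  unfold SC.dim at hd; omega

lemma card_le (hd : Δ.dim = (d : ℤ)) {σ : Finset (Fin n)} (hσ : σ ∈ Δ.faces) :
    σ.card ≤ d + 1 := by
  rw [← sup_eq hd]; exact Finset.le_sup (f := Finset.card) hσ

lemma exists_top (hd : Δ.dim = (d : ℤ)) : ∃ F ∈ Δ.faces, F.card = d + 1 := by
  obtain ⟨F, hF, h⟩ := Finset.exists_mem_eq_sup Δ.faces ⟨∅, Δ.empty_mem⟩ Finset.card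
  exact ⟨F, hF, by rw [← h, sup_eq hd]⟩

lemma facet_of_card (hd : Δ.dim = (d : ℤ)) {F : Finset (Fin n)} (hF : F ∈ Δ.faces)
    (hc : F.card = d + 1) : Δ.IsFacet F :=
  ⟨hF, fun τ hτ hs => Finset.eq_of_subset_of_card_le hs (by rw [hc]; exact card_le hd hτ)⟩

lemma exists_facet {σ : Finset (Fin n)} (hσ : σ ∈ Δ.faces) :
    ∃ F, Δ.IsFacet F ∧ σ ⊆ F := by
  obtain ⟨F, hF, hmax⟩ := Finset.exists_max_image (Δ.faces.filter fun τ => σ ⊆ τ) Finset.card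
    ⟨σ, by simp [hσ]⟩
  rw [Finset.mem_filter] at hF
  refine ⟨F, ⟨hF.1, fun τ hτ hs => Finset.eq_of_subset_of_card_le hs (hmax τ ?_)⟩, hF.2⟩
  rw [Finset.mem_filter]
  exact ⟨hτ, hF.2.trans hs⟩

lemma facet_card (hd : Δ.dim = (d : ℤ)) (hpm : Δ.IsPseudomanifold) {F : Finset (Fin n)}
    (hF : Δ.IsFacet F) : F.card = d + 1 := by
  obtain ⟨F0, hF0, hc⟩ := exists_top hd
  have hch := hpm.1 F0 F (facet_of_card hd hF0 hc) hF
  clear hF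
  induction hch with
  | refl => exact hc
  | @tail β γ _ hstep ih =>
    obtain ⟨hα, hβ, hi⟩ := hstep
    rw [hd] at hi
    have hi' : (β ∩ γ).card = d := by omega
    have h1 : (β ∩ γ).card ≤ γ.card := Finset.card_le_card Finset.inter_subset_right
    have h2 := card_le hd hβ.1
    by_contra hne
    have h3 : β ∩ γ = γ := Finset.eq_of_subset_of_card_le Finset.inter_subset_right (by omega)
    have h4 := hβ.2 β hα.1 (Finset.inter_eq_right.mp h3)
    rw [h4] at hne
    exact hne ih

lemma facet_iff (hd : Δ.dim = (d : ℤ)) (hpm : Δ.IsPseudomanifold) {F : Finset (Fin n)} :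
    Δ.IsFacet F ↔ F ∈ Δ.faces ∧ F.card = d + 1 :=
  ⟨fun h => ⟨h.1, facet_card hd hpm h⟩, fun h => facet_of_card hd h.1 h.2⟩

lemma insert_of_card {G F : Finset (Fin n)} (hs : G ⊆ F) (hc : F.card = G.card + 1) :
    ∃ u, u ∉ G ∧ F = insert u G := by
  have h1 : (F \ G).card = 1 := by rw [Finset.card_sdiff_of_subset hs]; omega
  obtain ⟨u, hu⟩ := Finset.card_eq_one.mp h1
  have hu' : u ∈ F \ G := by rw [hu]; simp
  rw [Finset.mem_sdiff] at hu'
  refine ⟨u, hu'.2, ?_⟩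
  rw [Finset.insert_eq, ← hu, Finset.sdiff_union_of_subset hs]

lemma exists_ridge (hd : Δ.dim = (d : ℤ)) (hpm : Δ.IsPseudomanifold) {G : Finset (Fin n)}
    (hG : G ∈ Δ.faces) (hc : G.card = d) : ∃ u v, Ridge Δ G u v := by
  have h := hpm.2 G hG (by rw [hd, hc])
  rw [Set.ncard_eq_two] at h
  obtain ⟨x, y, hxy, he⟩ := h
  have hx : x ∈ {σ : Finset (Fin n) | Δ.IsFacet σ ∧ G ⊆ σ} := by rw [he]; simp
  have hy : y ∈ {σ : Finset (Fin n) | Δ.IsFacet σ ∧ G ⊆ σ} := by rw [he]; simp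
  have hx2 := facet_card hd hpm hx.1
  have hy2 := facet_card hd hpm hy.1
  obtain ⟨u, hu, hux⟩ := insert_of_card hx.2 (by omega)
  obtain ⟨v, hv, hvy⟩ := insert_of_card hy.2 (by omega)
  have huv : u ≠ v := by
    rintro rfl
    exact hxy (hux.trans hvy.symm)
  refine ⟨u, v, ⟨hu, hv, huv, hux ▸ hx.1.1, hvy ▸ hy.1.1, ?_, ?_⟩⟩
  · intro h
    have := card_le hd h
    rw [Finset.card_insert_of_notMem (by simp [hu, huv]), Finset.card_insert_of_notMem hv] at this
    omega
  · intro j hj hju hjv h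
    have h1 : insert j G ∈ {σ : Finset (Fin n) | Δ.IsFacet σ ∧ G ⊆ σ} :=
      ⟨facet_of_card hd h (by rw [Finset.card_insert_of_notMem hj, hc]), Finset.subset_insert _ _⟩
    rw [he] at h1
    have hjm : j ∈ insert j G := Finset.mem_insert_self _ _
    rcases h1 with h1 | h1
    · rw [h1, hux] at hjm; simp [hj, hju] at hjm
    · rw [Set.mem_singleton_iff.mp h1, hvy] at hjm; simp [hj, hjv] at hjm

lemma Ridge.symm {G : Finset (Fin n)} {u v : Fin n} (h : Ridge Δ G u v) : Ridge Δ G v u :=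
  ⟨h.hv, h.hu, h.huv.symm, h.fv, h.fu, by rw [Finset.insert_comm]; exact h.nf,
    fun j a b c => h.only j a c b⟩

lemma Ridge.eq_or {G : Finset (Fin n)} {u v j : Fin n} (h : Ridge Δ G u v) (hj : j ∉ G)
    (hf : insert j G ∈ Δ.faces) : j = u ∨ j = v := by
  by_contra hc
  push Not at hc
  exact h.only j hj hc.1 hc.2 hf

lemma exists_ridge_at (hd : Δ.dim = (d : ℤ)) (hpm : Δ.IsPseudomanifold) {F : Finset (Fin n)}
    (hF : Δ.IsFacet F) {u : Fin n} (hu : u ∈ F) : ∃ v, Ridge Δ (F.erase u) u v := by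
  have hc := facet_card hd hpm hF
  obtain ⟨a, b, h⟩ := exists_ridge hd hpm (Δ.down_closed hF.1 (Finset.erase_subset u F))
    (by rw [Finset.card_erase_of_mem hu, hc]; rfl)
  rcases h.eq_or (j := u) (by simp) (by rw [Finset.insert_erase hu]; exact hF.1) with rfl | rfl
  · exact ⟨b, h⟩
  · exact ⟨a, h.symm⟩

lemma exists_codim (hd : Δ.dim = (d : ℤ)) (hpm : Δ.IsPseudomanifold) :
    ∃ c, n = (d + 1) + (c + 1) := by
  obtain ⟨F, hF, hc⟩ := exists_top hd
  have hne : F.Nonempty := by rw [← Finset.card_pos]; omega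
  obtain ⟨u, hu⟩ := hne
  obtain ⟨v, h⟩ := exists_ridge_at hd hpm (facet_of_card hd hF hc) hu
  have h1 : (insert u (insert v (F.erase u))).card = d + 2 := by
    rw [Finset.card_insert_of_notMem (by simp [h.huv]), Finset.card_insert_of_notMem h.hv,
      Finset.card_erase_of_mem hu]; omega
  have h2 := Finset.card_le_univ (insert u (insert v (F.erase u)))
  rw [Fintype.card_fin] at h2
  exact ⟨n - (d + 2), by omega⟩

/-- one step between adjacent facets across a ridge containing `σ` -/
def Step (Δ : SC n) (d : ℕ) (σ α β : Finset (Fin n)) : Prop :=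
  ∃ G u v, Ridge Δ G u v ∧ σ ⊆ G ∧ G.card = d ∧ α = insert u G ∧ β = insert v G

lemma Step.mono {σ τ α β : Finset (Fin n)} (h : σ ⊆ τ) (hs : Step Δ d τ α β) :
    Step Δ d σ α β := by
  obtain ⟨G, u, v, h1, h2, h3⟩ := hs
  exact ⟨G, u, v, h1, h.trans h2, h3⟩

lemma strong (hd : Δ.dim = (d : ℤ)) (hpm : Δ.IsPseudomanifold) (hnorm : Δ.Normal) (t : ℕ) :
    ∀ σ ∈ Δ.faces, σ.card + t = d + 1 → ∀ F F', Δ.IsFacet F → Δ.IsFacet F' → σ ⊆ F → σ ⊆ F' →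
      Relation.ReflTransGen (Step Δ d σ) F F' := by
  induction t with
  | zero =>
    intro σ hσ hc F F' hF hF' h h'
    have hf := facet_of_card hd hσ (by omega)
    rw [← hf.2 F hF.1 h, ← hf.2 F' hF'.1 h']
  | succ t ih =>
    intro σ hσ hc F F' hF hF' h h'
    have hFc := facet_card hd hpm hF
    have hFc' := facet_card hd hpm hF'
    have ih' : ∀ a, a ∉ σ → insert a σ ∈ Δ.faces → ∀ F F', Δ.IsFacet F → Δ.IsFacet F' →
        insert a σ ⊆ F → insert a σ ⊆ F' → Relation.ReflTransGen (Step Δ d σ) F F' := by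
      intro a ha hf F F' h1 h2 h3 h4
      refine Relation.ReflTransGen.mono (fun α β hs => Step.mono (Finset.subset_insert a σ) hs) _ _
        (ih (insert a σ) hf ?_ F F' h1 h2 h3 h4)
      rw [Finset.card_insert_of_notMem ha]; omega
    by_cases ht : t = 0
    · have hσd : σ.card = d := by omega
      obtain ⟨u, hu, rfl⟩ := insert_of_card h (by omega)
      obtain ⟨v, hv, rfl⟩ := insert_of_card h' (by omega)
      by_cases huv : u = v
      · subst huv; exact Relation.ReflTransGen.refl
      · obtain ⟨a, b, hr⟩ := exists_ridge hd hpm hσ hσd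
        have hr' : Ridge Δ σ u v := by
          rcases hr.eq_or hu hF.1 with rfl | rfl <;> rcases hr.eq_or hv hF'.1 with rfl | rfl
          · exact absurd rfl huv
          · exact hr
          · exact hr.symm
          · exact absurd rfl huv
        exact Relation.ReflTransGen.single ⟨σ, u, v, hr', subset_rfl, hσd, rfl, rfl⟩
    · have hconn := (hnorm σ hσ (by rw [hd]; omega)).2
      have key : ∀ H : Finset (Fin n), Δ.IsFacet H → σ ⊆ H → ∃ a, a ∉ σ ∧ insert a σ ⊆ H := by
        intro H hH hs
        have : ∃ a ∈ H, a ∉ σ := by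
          by_contra hcon
          push Not at hcon
          have := Finset.card_le_card (show H ⊆ σ from hcon)
          have := facet_card hd hpm hH
          omega
        obtain ⟨a, h1, h2⟩ := this
        exact ⟨a, h2, Finset.insert_subset h1 hs⟩
      have hvert : ∀ H : Finset (Fin n), Δ.IsFacet H → ∀ a, a ∉ σ → insert a σ ⊆ H →
          (Δ.link σ hσ).IsVertex a := by
        intro H hH a ha hs
        simp only [SC.IsVertex, SC.link, Finset.mem_filter]
        refine ⟨Δ.down_closed hH.1 ?_, ?_, Δ.down_closed hH.1 hs⟩
        · rw [Finset.singleton_subset_iff]; exact hs (Finset.mem_insert_self _ _)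
        · rw [Finset.singleton_inter_of_notMem ha]
      obtain ⟨a, ha, haF⟩ := key F hF h
      obtain ⟨b, hb, hbF⟩ := key F' hF' h'
      have hpath := hconn a b (hvert F hF a ha haF) (hvert F' hF' b hb hbF)
      have main : ∀ x, Relation.ReflTransGen
          (fun a b => ({a, b} : Finset (Fin n)) ∈ (Δ.link σ hσ).faces) a x →
          ∀ H, Δ.IsFacet H → insert x σ ⊆ H → x ∉ σ →
            Relation.ReflTransGen (Step Δ d σ) F H := by
        intro x hx
        induction hx with
        | refl =>
          intro H hH hs _
          exact ih' a ha (Δ.down_closed hF.1 haF) F H hF hH haF hs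
        | @tail x y _ hxy ihx =>
          intro H hH hs hy
          simp only [SC.link, Finset.mem_filter] at hxy
          obtain ⟨K, hK, hKs⟩ := exists_facet hxy.2.2
          have hxσ : x ∉ σ := by
            intro hx
            have : x ∈ ({x, y} : Finset (Fin n)) ∩ σ := by simp [hx]
            rw [hxy.2.1] at this
            simp at this
          have h1 : insert x σ ⊆ K := by
            refine subset_trans ?_ hKs
            intro z hz
            rcases Finset.mem_insert.mp hz with rfl | hz
            · simp
            · simp [hz]
          have h2 : insert y σ ⊆ K := by
            refine subset_trans ?_ hKs
            intro z hz
            rcases Finset.mem_insert.mp hz with rfl | hz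
            · simp
            · simp [hz]
          exact (ihx K hK h1 hxσ).trans (ih' y hy (Δ.down_closed hK.1 h2) K H hK hH h2 hs)
      exact main b hpath F' hF' hbF hb

lemma strong' (hd : Δ.dim = (d : ℤ)) (hpm : Δ.IsPseudomanifold) (hnorm : Δ.Normal)
    {σ F F' : Finset (Fin n)} (hF : Δ.IsFacet F) (hF' : Δ.IsFacet F') (h : σ ⊆ F) (h' : σ ⊆ F') :
    Relation.ReflTransGen (Step Δ d σ) F F' := by
  have hσ := Δ.down_closed hF.1 h
  exact strong hd hpm hnorm (d + 1 - σ.card) σ hσ (by have := card_le hd hσ; omega) F F' hF hF' h h'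

end Comb
end CanonPf

namespace CanonPf

section Hom
variable {n : ℕ} {Δ : SC n} {d : ℕ}

/-- incidence sign -/
def sg (R : Type) [CommRing R] (G : Finset (Fin n)) (u : Fin n) : R :=
  (-1) ^ (G.filter (fun w => w < u)).card

lemma sg_sq (R : Type) [CommRing R] (G : Finset (Fin n)) (u : Fin n) : sg R G u * sg R G u = 1 := by
  rw [sg, ← pow_add, ← two_mul, pow_mul]; simp

lemma sg_or (R : Type) [CommRing R] (G : Finset (Fin n)) (u : Fin n) :
    sg R G u = 1 ∨ sg R G u = -1 := neg_one_pow_eq_or R _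

lemma relBMat_insert (R : Type) [CommRing R] (σ : Finset (Fin n)) (i : ℕ) (ρ : Δ.RFace σ i)
    (τ : Δ.RFace σ (i+1)) (u : Fin n) (hu : u ∉ ρ.1) (h : τ.1 = insert u ρ.1) :
    Δ.relBMat R σ i ρ τ = sg R ρ.1 u := by
  have huσ : u ∉ σ := fun hh => hu (ρ.2.2.1 hh)
  unfold SC.relBMat
  rw [Finset.sum_eq_single u]
  · rw [if_pos ⟨huσ, by rw [h, Finset.erase_insert hu]⟩, sg, h, Finset.filter_insert,
      if_neg (lt_irrefl u)]
  · intro b hb hbu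
    rw [if_neg]
    rintro ⟨-, he⟩
    have : u ∈ τ.1.erase b := by
      rw [Finset.mem_erase, h]; exact ⟨hbu.symm, Finset.mem_insert_self _ _⟩
    rw [he] at this
    exact hu this
  · intro hn
    exact absurd (by rw [h]; exact Finset.mem_insert_self _ _) hn

lemma relBMat_ne (R : Type) [CommRing R] (σ : Finset (Fin n)) (i : ℕ) (ρ : Δ.RFace σ i)
    (τ : Δ.RFace σ (i+1)) (h : Δ.relBMat R σ i ρ τ ≠ 0) : ∃ u, u ∉ ρ.1 ∧ τ.1 = insert u ρ.1 := by
  unfold SC.relBMat at h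
  obtain ⟨u, hu, h1⟩ := Finset.exists_ne_zero_of_sum_ne_zero h
  have h2 : u ∉ σ ∧ τ.1.erase u = ρ.1 := by
    by_contra hc
    rw [if_neg hc] at h1
    exact h1 rfl
  refine ⟨u, ?_, ?_⟩
  · rw [← h2.2]; simp
  · rw [← h2.2, Finset.insert_erase hu]

/-- the face `insert u ρ` of the relative chain complex -/
def insF {σ : Finset (Fin n)} {i : ℕ} (ρ : Δ.RFace σ i) (u : Fin n) (hu : u ∉ ρ.1)
    (hf : insert u ρ.1 ∈ Δ.faces) : Δ.RFace σ (i+1) :=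
  ⟨insert u ρ.1, hf, ρ.2.2.1.trans (Finset.subset_insert _ _), by
    rw [Finset.card_insert_of_notMem hu, ρ.2.2.2]⟩

lemma bdry (R : Type) [CommRing R] (σ : Finset (Fin n)) (i : ℕ) (ρ : Δ.RFace σ i) {u v : Fin n}
    (hr : Ridge Δ ρ.1 u v) (z : Δ.relChain R σ (i+1)) :
    Δ.relBoundary R σ i z ρ = sg R ρ.1 u * z (insF ρ u hr.hu hr.fu) +
      sg R ρ.1 v * z (insF ρ v hr.hv hr.fv) := by
  unfold SC.relBoundary
  rw [Matrix.mulVecLin_apply, Matrix.mulVec, dotProduct]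
  rw [Finset.sum_eq_add (insF ρ u hr.hu hr.fu) (insF ρ v hr.hv hr.fv)]
  · rw [relBMat_insert R σ i ρ _ u hr.hu rfl, relBMat_insert R σ i ρ _ v hr.hv rfl]
  · intro he
    have he' : insert u ρ.1 = insert v ρ.1 := congrArg Subtype.val he
    have : u ∈ insert v ρ.1 := by rw [← he']; exact Finset.mem_insert_self _ _
    simp [hr.huv, hr.hu] at this
  · rintro τ - ⟨h1, h2⟩
    by_contra hne
    obtain ⟨x, hx, hτ⟩ := relBMat_ne R σ i ρ τ (left_ne_zero_of_mul hne)
    rcases hr.eq_or hx (hτ ▸ τ.2.1) with rfl | rfl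
    · exact h1 (Subtype.ext hτ)
    · exact h2 (Subtype.ext hτ)
  · intro h; exact absurd (Finset.mem_univ _) h
  · intro h; exact absurd (Finset.mem_univ _) h

/-- cycles, as functions on all finsets -/
def IsCyc (R : Type) [CommRing R] (Δ : SC n) (d : ℕ) (σ : Finset (Fin n))
    (Z : Finset (Fin n) → R) : Prop :=
  ∀ G u v, Ridge Δ G u v → σ ⊆ G → G.card = d →
    sg R G u * Z (insert u G) + sg R G v * Z (insert v G) = 0

open Classical in
/-- extension by zero -/
noncomputable def extz {R : Type} [CommRing R] {σ : Finset (Fin n)} {c : ℕ}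
    (z : Δ.relChain R σ c) (τ : Finset (Fin n)) : R :=
  if h : τ ∈ Δ.faces ∧ σ ⊆ τ ∧ τ.card = c then z ⟨τ, h⟩ else 0

lemma extz_val {R : Type} [CommRing R] {σ : Finset (Fin n)} {c : ℕ}
    (z : Δ.relChain R σ c) (τ : Δ.RFace σ c) : extz z τ.1 = z τ := by
  unfold extz
  rw [dif_pos τ.2]
  rfl

lemma isCyc_of_ker {R : Type} [CommRing R] {σ : Finset (Fin n)} (z : Δ.relChain R σ (d+1))
    (hz : Δ.relBoundary R σ d z = 0) : IsCyc R Δ d σ (extz z) := by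
  intro G u v hr hσ hc
  have hG : G ∈ Δ.faces := Δ.down_closed hr.fu (Finset.subset_insert _ _)
  have := bdry R σ d ⟨G, hG, hσ, hc⟩ hr z
  rw [hz, ← extz_val z, ← extz_val z] at this
  exact this.symm

lemma ker_of_isCyc {R : Type} [CommRing R] {σ : Finset (Fin n)} (hd : Δ.dim = (d : ℤ))
    (hpm : Δ.IsPseudomanifold) (Z : Finset (Fin n) → R) (hZ : IsCyc R Δ d σ Z) :
    Δ.relBoundary R σ d (fun τ => Z τ.1) = 0 := by
  funext ρ
  obtain ⟨u, v, hr⟩ := exists_ridge hd hpm ρ.2.1 ρ.2.2.2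
  rw [bdry R σ d ρ hr]
  exact hZ ρ.1 u v hr ρ.2.2.1 ρ.2.2.2

lemma range_bot (R : Type) [CommRing R] (hd : Δ.dim = (d : ℤ)) (σ : Finset (Fin n)) :
    LinearMap.range (Δ.relBoundary R σ (d+1)) = ⊥ := by
  rw [LinearMap.range_eq_bot]
  refine LinearMap.ext fun z => ?_
  have : z = 0 := by
    funext τ
    have := card_le hd τ.2.1
    have := τ.2.2.2
    omega
  rw [this, map_zero, map_zero]

lemma homology_equiv (R : Type) [CommRing R] (hd : Δ.dim = (d : ℤ)) (σ : Finset (Fin n)) :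
    Nonempty (Δ.relHomology R σ d ≃ₗ[R] LinearMap.ker (Δ.relBoundary R σ d)) := by
  refine ⟨Submodule.quotEquivOfEqBot _ ?_⟩
  rw [range_bot R hd, Submodule.comap_bot, Submodule.ker_subtype]

lemma cyc_step {R : Type} [CommRing R] {σ α β : Finset (Fin n)} {Z : Finset (Fin n) → R}
    (hZ : IsCyc R Δ d σ Z) (h : Step Δ d σ α β) : Z β = Z α ∨ Z β = - Z α := by
  obtain ⟨G, u, v, hr, hs, hc, rfl, rfl⟩ := h
  have := hZ G u v hr hs hc
  rcases sg_or R G u with h1 | h1 <;> rcases sg_or R G v with h2 | h2 <;> rw [h1, h2] at this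
  · right; linear_combination this
  · left; linear_combination -this
  · left; linear_combination this
  · right; linear_combination -this

lemma cyc_chain {R : Type} [CommRing R] {σ α β : Finset (Fin n)} {Z : Finset (Fin n) → R}
    (hZ : IsCyc R Δ d σ Z) (h : Relation.ReflTransGen (Step Δ d σ) α β) :
    Z β = Z α ∨ Z β = - Z α := by
  induction h with
  | refl => left; rfl
  | tail _ hs ih =>
    rcases cyc_step hZ hs with h1 | h1 <;> rcases ih with h2 | h2 <;> rw [h1, h2] <;> simp

variable {k : Type} [Field k]

lemma h_le_one (hd : Δ.dim = (d : ℤ)) (hpm : Δ.IsPseudomanifold) (hnorm : Δ.Normal)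
    {σ : Finset (Fin n)} (hσ : σ ∈ Δ.faces) : Module.finrank k (Δ.relHomology k σ d) ≤ 1 := by
  obtain ⟨e⟩ := homology_equiv k hd σ
  rw [e.finrank_eq]
  obtain ⟨F, hF, hs⟩ := exists_facet hσ
  let f : LinearMap.ker (Δ.relBoundary k σ d) →ₗ[k] k :=
    (LinearMap.proj (⟨F, hF.1, hs, facet_card hd hpm hF⟩ : Δ.RFace σ (d+1))).comp
      (Submodule.subtype _)
  have hf : Function.Injective f := by
    rw [← LinearMap.ker_eq_bot, LinearMap.ker_eq_bot']
    rintro ⟨z, hz⟩ h0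
    have hcyc := isCyc_of_ker z hz
    have h0' : extz z F = 0 :=
      (extz_val z ⟨F, hF.1, hs, facet_card hd hpm hF⟩).trans h0
    ext τ
    have hτ := facet_of_card hd τ.2.1 τ.2.2.2
    change z τ = 0
    rw [← extz_val z]
    rcases cyc_chain hcyc (strong' hd hpm hnorm hF hτ hs τ.2.2.1) with h | h <;> rw [h, h0']
    exact neg_zero
  have := LinearMap.finrank_le_finrank_of_injective hf
  simpa using this

lemma h_nonface (hd : Δ.dim = (d : ℤ)) {σ : Finset (Fin n)} (hσ : σ ∉ Δ.faces) :
    Module.finrank k (Δ.relHomology k σ d) = 0 := by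
  obtain ⟨e⟩ := homology_equiv k hd σ
  rw [e.finrank_eq]
  have : Subsingleton (LinearMap.ker (Δ.relBoundary k σ d)) := by
    constructor
    rintro ⟨a, _⟩ ⟨b, _⟩
    ext τ
    exact absurd (Δ.down_closed τ.2.1 τ.2.2.1) hσ
  exact Module.finrank_zero_of_subsingleton

lemma h_ne_zero (hd : Δ.dim = (d : ℤ)) (hpm : Δ.IsPseudomanifold)
    {σ : Finset (Fin n)} {Z : Finset (Fin n) → k} (hZ : IsCyc k Δ d σ Z) {F : Finset (Fin n)}
    (hF : Δ.IsFacet F) (hs : σ ⊆ F) (hZF : Z F ≠ 0) :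
    Module.finrank k (Δ.relHomology k σ d) ≠ 0 := by
  obtain ⟨e⟩ := homology_equiv k hd σ
  rw [e.finrank_eq]
  have : Nontrivial (LinearMap.ker (Δ.relBoundary k σ d)) := by
    refine ⟨⟨⟨_, ker_of_isCyc hd hpm Z hZ⟩, 0, ?_⟩⟩
    intro h
    have h1 := congrArg Subtype.val h
    have h2 := congrFun h1 (⟨F, hF.1, hs, facet_card hd hpm hF⟩ : Δ.RFace σ (d+1))
    exact hZF h2
  have h := Module.finrank_pos (R := k) (M := LinearMap.ker (Δ.relBoundary k σ d))
  omega

lemma exists_cyc {R : Type} [CommRing R] {σ : Finset (Fin n)}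
    (h : Nontrivial (LinearMap.ker (Δ.relBoundary R σ d))) :
    ∃ Z : Finset (Fin n) → R, IsCyc R Δ d σ Z ∧ ∃ τ : Δ.RFace σ (d+1), Z τ.1 ≠ 0 := by
  obtain ⟨⟨z, hz⟩, h0⟩ := exists_ne (0 : LinearMap.ker (Δ.relBoundary R σ d))
  refine ⟨extz z, isCyc_of_ker z hz, ?_⟩
  by_contra hc
  push Not at hc
  apply h0
  ext τ
  exact (extz_val z τ).symm.trans (hc τ)

lemma exists_cyc_of_h (hd : Δ.dim = (d : ℤ))
    {σ : Finset (Fin n)} (h : Module.finrank k (Δ.relHomology k σ d) ≠ 0) :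
    ∃ Z : Finset (Fin n) → k, IsCyc k Δ d σ Z ∧ ∃ F, Δ.IsFacet F ∧ σ ⊆ F ∧ Z F ≠ 0 := by
  obtain ⟨e⟩ := homology_equiv k hd σ
  rw [e.finrank_eq] at h
  obtain ⟨Z, h1, τ, h2⟩ := exists_cyc (Module.nontrivial_of_finrank_pos (Nat.pos_of_ne_zero h))
  exact ⟨Z, h1, τ.1, facet_of_card hd τ.2.1 τ.2.2.2, τ.2.2.1, h2⟩

lemma h_facet (hd : Δ.dim = (d : ℤ)) (hpm : Δ.IsPseudomanifold)
    {F : Finset (Fin n)} (hF : Δ.IsFacet F) :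
    Module.finrank k (Δ.relHomology k F d) ≠ 0 := by
  refine h_ne_zero hd hpm (Z := fun _ => 1) ?_ hF subset_rfl one_ne_zero
  intro G u v _ hs hc
  have := Finset.card_le_card hs
  have := facet_card hd hpm hF
  omega

lemma h_char2 (hd : Δ.dim = (d : ℤ)) (hpm : Δ.IsPseudomanifold) (h2 : (2 : k) = 0)
    {σ : Finset (Fin n)} (hσ : σ ∈ Δ.faces) :
    Module.finrank k (Δ.relHomology k σ d) ≠ 0 := by
  obtain ⟨F, hF, hs⟩ := exists_facet hσ
  refine h_ne_zero hd hpm (Z := fun _ => 1) ?_ hF hs one_ne_zero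
  intro G u v _ hs hc
  rcases sg_or k G u with h1 | h1 <;> rcases sg_or k G v with h3 | h3 <;> rw [h1, h3]
  · linear_combination h2
  · ring
  · ring
  · linear_combination -h2

end Hom
end CanonPf

namespace CanonPf

section LinkOr
variable {n : ℕ} {Δ : SC n} {d : ℕ}

lemma mem_link {σ τ : Finset (Fin n)} (hσ : σ ∈ Δ.faces) :
    τ ∈ (Δ.link σ hσ).faces ↔ τ ∈ Δ.faces ∧ τ ∩ σ = ∅ ∧ τ ∪ σ ∈ Δ.faces := by
  simp [SC.link]

lemma sdiff_mem_link {σ H : Finset (Fin n)} (hσ : σ ∈ Δ.faces) (hs : σ ⊆ H) :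
    H \ σ ∈ (Δ.link σ hσ).faces ↔ H ∈ Δ.faces := by
  rw [mem_link, Finset.sdiff_union_of_subset hs]
  constructor
  · exact fun h => h.2.2
  · exact fun h => ⟨Δ.down_closed h Finset.sdiff_subset, by simp, h⟩

lemma link_dim (hd : Δ.dim = (d : ℤ)) (hpm : Δ.IsPseudomanifold) {σ : Finset (Fin n)}
    (hσ : σ ∈ Δ.faces) (hc : σ.card ≤ d) : (Δ.link σ hσ).dim = ((d - σ.card : ℕ) : ℤ) := by
  have : (Δ.link σ hσ).faces.sup Finset.card = d + 1 - σ.card := by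
    apply le_antisymm
    · refine Finset.sup_le fun τ hτ => ?_
      rw [mem_link] at hτ
      have h1 := card_le hd hτ.2.2
      rw [Finset.card_union_of_disjoint (Finset.disjoint_iff_inter_eq_empty.mpr hτ.2.1)] at h1
      omega
    · obtain ⟨F, hF, hs⟩ := exists_facet hσ
      have h1 := Finset.le_sup (f := Finset.card) ((sdiff_mem_link hσ hs).mpr hF.1)
      rwa [Finset.card_sdiff_of_subset hs, facet_card hd hpm hF] at h1
  unfold SC.dim
  omega

lemma link_ridge {σ G : Finset (Fin n)} {u v : Fin n} (hσ : σ ∈ Δ.faces) (hs : σ ⊆ G)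
    (hr : Ridge Δ G u v) : Ridge (Δ.link σ hσ) (G \ σ) u v := by
  have key : ∀ (H : Finset (Fin n)) (j : Fin n), j ∉ σ → insert j (H \ σ) = insert j H \ σ :=
    fun H j hj => (Finset.insert_sdiff_of_notMem _ hj).symm
  have hu : u ∉ σ := fun h => hr.hu (hs h)
  have hv : v ∉ σ := fun h => hr.hv (hs h)
  refine ⟨by simp [hr.hu], by simp [hr.hv], hr.huv, ?_, ?_, ?_, ?_⟩
  · rw [key _ _ hu, sdiff_mem_link hσ (hs.trans (Finset.subset_insert _ _))]; exact hr.fu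
  · rw [key _ _ hv, sdiff_mem_link hσ (hs.trans (Finset.subset_insert _ _))]; exact hr.fv
  · rw [key _ _ hv, key _ _ hu, sdiff_mem_link hσ ((hs.trans (Finset.subset_insert _ _)).trans
      (Finset.subset_insert _ _))]; exact hr.nf
  · intro j hj hju hjv hf
    have hjσ : j ∉ σ := by
      intro h
      rw [mem_link] at hf
      have : j ∈ insert j (G \ σ) ∩ σ := by simp [h]
      rw [hf.2.1] at this
      simp at this
    rw [key _ _ hjσ, sdiff_mem_link hσ (hs.trans (Finset.subset_insert _ _))] at hf
    exact hr.only j (fun h => hj (by simp [h, hjσ])) hju hjv hf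

/-- number of inversions -/
def inv' (α σ : Finset (Fin n)) : ℕ := ∑ w ∈ α, (σ.filter (fun v => v < w)).card

lemma sg_sdiff (R : Type) [CommRing R] {σ G : Finset (Fin n)} (hs : σ ⊆ G) {u : Fin n}
    (hu : u ∉ G) (Z : R) :
    sg R G u * ((-1) ^ inv' (insert u G \ σ) σ * Z) =
      (-1) ^ inv' (G \ σ) σ * (sg R (G \ σ) u * Z) := by
  have huσ : u ∉ σ := fun h => hu (hs h)
  have h1 : inv' (insert u G \ σ) σ = (σ.filter (fun v => v < u)).card + inv' (G \ σ) σ := by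
    rw [Finset.insert_sdiff_of_notMem _ huσ, inv', Finset.sum_insert (by simp [hu]), inv']
  have h2 : (G.filter (fun w => w < u)).card =
      ((G \ σ).filter (fun w => w < u)).card + (σ.filter (fun w => w < u)).card := by
    rw [← Finset.card_union_of_disjoint, ← Finset.filter_union, Finset.sdiff_union_of_subset hs]
    exact Finset.disjoint_filter_filter Finset.sdiff_disjoint
  have h3 : ((-1 : R) ^ (σ.filter (fun w => w < u)).card) *
      ((-1 : R) ^ (σ.filter (fun w => w < u)).card) = 1 := by
    rw [← pow_add, ← two_mul, pow_mul]; simp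
  rw [sg, sg, h1, h2, pow_add, pow_add]
  linear_combination ((-1) ^ ((G \ σ).filter (fun w => w < u)).card * (-1) ^ inv' (G \ σ) σ * Z) * h3

variable {k : Type} [Field k]

lemma h_manifold (hd : Δ.dim = (d : ℤ)) (hpm : Δ.IsPseudomanifold) (hm : Δ.IsHomologyManifold k)
    {σ : Finset (Fin n)} (hσ : σ ∈ Δ.faces) (hne : σ ≠ ∅) :
    Module.finrank k (Δ.relHomology k σ d) ≠ 0 := by
  by_cases hc : σ.card = d + 1
  · exact h_facet hd hpm (facet_of_card hd hσ hc)
  have hc' : σ.card ≤ d := by have := card_le hd hσ; omega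
  have hdim := link_dim hd hpm hσ hc'
  obtain ⟨e⟩ := ((hm.2 σ hσ hne).1 (d - σ.card)).1 hdim.symm
  obtain ⟨e'⟩ := homology_equiv k hdim ∅
  have hnt : Nontrivial (LinearMap.ker ((Δ.link σ hσ).relBoundary k ∅ (d - σ.card))) :=
    (e'.symm.trans e).toEquiv.nontrivial
  obtain ⟨Z, hZ, τ, hτ⟩ := exists_cyc hnt
  have hτl := (mem_link hσ).mp τ.2.1
  have hdisj : Disjoint τ.1 σ := Finset.disjoint_iff_inter_eq_empty.mpr hτl.2.1
  refine h_ne_zero hd hpm (σ := σ) (Z := fun H => (-1) ^ inv' (H \ σ) σ * Z (H \ σ)) ?_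
    (F := τ.1 ∪ σ) ?_ Finset.subset_union_right ?_
  · intro G u v hr hs hG
    have h1 := hZ (G \ σ) u v (link_ridge hσ hs hr) (Finset.empty_subset _)
      (by rw [Finset.card_sdiff_of_subset hs, hG])
    have hu : u ∉ σ := fun h => hr.hu (hs h)
    have hv : v ∉ σ := fun h => hr.hv (hs h)
    rw [sg_sdiff k hs hr.hu, sg_sdiff k hs hr.hv, ← mul_add, Finset.insert_sdiff_of_notMem _ hu,
      Finset.insert_sdiff_of_notMem _ hv, h1, mul_zero]
  · refine facet_of_card hd hτl.2.2 ?_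
    rw [Finset.card_union_of_disjoint hdisj, τ.2.2.2]; omega
  · have : (τ.1 ∪ σ) \ σ = τ.1 := by
      rw [Finset.union_sdiff_right, Finset.sdiff_eq_self_of_disjoint hdisj]
    simp only [this]
    refine mul_ne_zero ?_ hτ
    exact pow_ne_zero _ (by simp)

lemma d_pos (hd : Δ.dim = (d : ℤ)) (hpm : Δ.IsPseudomanifold) (hc : Δ.Connected) : d ≠ 0 := by
  rintro rfl
  obtain ⟨u, v, hr⟩ := exists_ridge hd hpm Δ.empty_mem rfl
  have hpath := hc.2 u v hr.fu hr.fv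
  apply hr.huv
  clear hr
  induction hpath with
  | refl => rfl
  | @tail x y _ h ih =>
    rw [ih]
    by_contra hne
    have := card_le hd h
    rw [Finset.card_pair hne] at this
    omega

lemma sign_cyc {R : Type} [CommRing R] [IsDomain R] (h2 : (2 : R) ≠ 0)
    (hd : Δ.dim = (d : ℤ)) (hpm : Δ.IsPseudomanifold) (hnorm : Δ.Normal)
    {Z : Finset (Fin n) → R} (hZ : IsCyc R Δ d ∅ Z) {F0 : Finset (Fin n)} (hF0 : Δ.IsFacet F0)
    (h0 : Z F0 ≠ 0) : ∃ ε : Finset (Fin n) → ℤ, IsCyc ℤ Δ d ∅ ε ∧ ε F0 = 1 := by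
  classical
  have hne : - Z F0 ≠ Z F0 := by
    intro h
    have : 2 * Z F0 = 0 := by linear_combination -h
    rcases mul_eq_zero.mp this with h | h
    · exact h2 h
    · exact h0 h
  refine ⟨fun F => if Z F = Z F0 then 1 else -1, ?_, by simp⟩
  have key : ∀ F, Δ.IsFacet F → Z F = ((if Z F = Z F0 then 1 else -1 : ℤ) : R) * Z F0 := by
    intro F hF
    rcases cyc_chain hZ (strong' hd hpm hnorm hF0 hF (Finset.empty_subset _)
      (Finset.empty_subset _)) with h | h
    · rw [if_pos h, h]; simp
    · rw [if_neg (by rw [h]; exact hne), h]; simp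
  have cast_sg : ∀ (G : Finset (Fin n)) u, sg R G u = ((sg ℤ G u : ℤ) : R) := by
    intro G u; simp [sg]
  intro G u v hr hs hc
  have h := hZ G u v hr hs hc
  rw [key (insert u G) (facet_of_card hd hr.fu (by rw [Finset.card_insert_of_notMem hr.hu, hc])),
    key (insert v G) (facet_of_card hd hr.fv (by rw [Finset.card_insert_of_notMem hr.hv, hc])),
    cast_sg, cast_sg, ← mul_assoc, ← mul_assoc, ← add_mul] at h
  have h' := (mul_eq_zero.mp h).resolve_right h0
  have hA : ∀ P : Prop, [Decidable P] → (if P then (1:ℤ) else -1) = 1 ∨ (if P then (1:ℤ) else -1) = -1 := by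
    intro P _; split_ifs <;> simp
  rcases sg_or ℤ G u with h1 | h1 <;> rcases sg_or ℤ G v with h3 | h3 <;>
    rcases hA (Z (insert u G) = Z F0) with h4 | h4 <;>
    rcases hA (Z (insert v G) = Z F0) with h5 | h5 <;>
    simp only [h1, h3, h4, h5] at h' ⊢ <;> first
      | norm_num; done
      | (exfalso; push_cast at h'; exact h2 (by linear_combination h'))
      | (exfalso; push_cast at h'; exact h2 (by linear_combination -h'))

lemma orientable_iff (h2 : (2 : k) ≠ 0)
    (hd : Δ.dim = (d : ℤ)) (hpm : Δ.IsPseudomanifold) (hnorm : Δ.Normal) (hc : Δ.Connected) :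
    Δ.Orientable ℤ ↔ Module.finrank k (Δ.relHomology k ∅ d) ≠ 0 := by
  have hd0 := d_pos hd hpm hc
  have hor : Δ.Orientable ℤ ↔ Nontrivial (LinearMap.ker (Δ.relBoundary ℤ ∅ d)) := by
    have he : Nonempty (Δ.homologyUnred ℤ d ≃ₗ[ℤ] LinearMap.ker (Δ.relBoundary ℤ ∅ d)) := by
      have h1 : Δ.cyclesUnred ℤ d = LinearMap.ker (Δ.relBoundary ℤ ∅ d) := by
        rw [SC.cyclesUnred, if_neg hd0]
      rw [← h1]
      refine ⟨Submodule.quotEquivOfEqBot _ ?_⟩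
      rw [range_bot ℤ hd, Submodule.comap_bot, Submodule.ker_subtype]
    obtain ⟨e⟩ := he
    constructor
    · rintro ⟨d', hd', h⟩
      have : d' = d := by rw [hd] at hd'; exact_mod_cast hd'.symm
      subst this
      exact e.symm.toEquiv.nontrivial
    · intro h
      exact ⟨d, hd, e.toEquiv.nontrivial⟩
  rw [hor]
  constructor
  · intro h
    obtain ⟨Z, hZ, τ, hτ⟩ := exists_cyc h
    obtain ⟨ε, hε, h1⟩ := sign_cyc two_ne_zero hd hpm hnorm hZ
      (facet_of_card hd τ.2.1 τ.2.2.2) hτ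
    refine h_ne_zero hd hpm (Z := fun F => ((ε F : ℤ) : k)) ?_
      (facet_of_card hd τ.2.1 τ.2.2.2) (Finset.empty_subset _) (by simp [h1])
    intro G u v hr hs hc
    have := hε G u v hr hs hc
    have h3 := congrArg (Int.cast : ℤ → k) this
    push_cast at h3
    simpa [sg] using h3
  · intro h
    obtain ⟨Z, hZ, F, hF, hs, hZF⟩ := exists_cyc_of_h hd h
    obtain ⟨ε, hε, h1⟩ := sign_cyc h2 hd hpm hnorm hZ hF hZF
    have := ker_of_isCyc hd hpm ε hε
    refine ⟨⟨⟨_, this⟩, 0, ?_⟩⟩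
    intro h
    have h1' := congrArg Subtype.val h
    have h2' := congrFun h1' (⟨F, hF.1, hs, facet_card hd hpm hF⟩ : Δ.RFace ∅ (d+1))
    have h3 : ε F = 0 := h2'
    rw [h1] at h3
    exact one_ne_zero h3

end LinkOr
end CanonPf

namespace CanonPf
open MvPolynomial

section Proj
variable {k : Type} [Field k] {ι : Type} [DecidableEq ι] {ω : Type} [AddCommGroup ω] [Module k ω]
  {gr : ι → Submodule k ω}

/-- projection to a graded component -/
noncomputable def pr (h : DirectSum.IsInternal gr) (a : ι) : ω →ₗ[k] ω :=
  (gr a).subtype ∘ₗ DirectSum.component k ι (fun i => gr i) a ∘ₗ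
    (LinearEquiv.ofBijective (DirectSum.coeLinearMap gr) h).symm.toLinearMap

lemma pr_mem (h : DirectSum.IsInternal gr) (a : ι) (x : ω) : pr h a x ∈ gr a := by
  simp [pr]

lemma symm_of_mem (h : DirectSum.IsInternal gr) {a : ι} {x : ω} (hx : x ∈ gr a) :
    (LinearEquiv.ofBijective (DirectSum.coeLinearMap gr) h).symm x =
      DirectSum.lof k ι (fun i => gr i) a ⟨x, hx⟩ := by
  rw [LinearEquiv.symm_apply_eq]
  exact (DirectSum.coeLinearMap_lof (A := gr) (i := a) ⟨x, hx⟩).symm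

lemma pr_same (h : DirectSum.IsInternal gr) {a : ι} {x : ω} (hx : x ∈ gr a) : pr h a x = x := by
  simp only [pr, LinearMap.comp_apply, LinearEquiv.coe_coe, symm_of_mem h hx]
  rw [DirectSum.component.lof_self]; rfl

lemma pr_ne (h : DirectSum.IsInternal gr) {a b : ι} (hab : a ≠ b) {x : ω} (hx : x ∈ gr a) :
    pr h b x = 0 := by
  simp only [pr, LinearMap.comp_apply, LinearEquiv.coe_coe, symm_of_mem h hx]
  rw [DirectSum.component.of, dif_neg hab]; rfl

lemma gr_induction (h : DirectSum.IsInternal gr) {P : ω → Prop} (h0 : P 0)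
    (hm : ∀ a, ∀ x ∈ gr a, P x) (ha : ∀ x y, P x → P y → P (x + y)) (x : ω) : P x := by
  have hx : x ∈ iSup gr := by rw [h.submodule_iSup_eq_top]; trivial
  exact Submodule.iSup_induction gr (motive := P) hx hm h0 ha

/-- elements whose components lie in degrees satisfying `P` -/
noncomputable def Conc (h : DirectSum.IsInternal gr) (P : ι → Prop) : Submodule k ω where
  carrier := {x | ∀ e, ¬ P e → pr h e x = 0}
  zero_mem' := fun e _ => map_zero _
  add_mem' := fun {x y} hx hy e he => by rw [map_add, hx e he, hy e he, add_zero]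
  smul_mem' := fun c x hx e he => by rw [map_smul, hx e he, smul_zero]

lemma mem_Conc (h : DirectSum.IsInternal gr) {P : ι → Prop} {x : ω} :
    x ∈ Conc h P ↔ ∀ e, ¬ P e → pr h e x = 0 := Iff.rfl

lemma gr_mem_Conc (h : DirectSum.IsInternal gr) {P : ι → Prop} {a : ι} (ha : P a) {x : ω}
    (hx : x ∈ gr a) : x ∈ Conc h P := by
  intro e he
  exact pr_ne h (by rintro rfl; exact he ha) hx

lemma gr_Conc_zero (h : DirectSum.IsInternal gr) {P : ι → Prop} {a : ι} (ha : ¬ P a) {x : ω}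
    (hx : x ∈ gr a) (hc : x ∈ Conc h P) : x = 0 := by
  rw [← pr_same h hx]; exact hc a ha

lemma Conc_disj (h : DirectSum.IsInternal gr) {P Q : ι → Prop} (hPQ : ∀ e, P e → Q e → False)
    {x : ω} (hP : x ∈ Conc h P) (hQ : x ∈ Conc h Q) : x = 0 := by
  have h0 : ∀ e, pr h e x = 0 := by
    intro e
    by_cases he : P e
    · exact hQ e (fun hq => hPQ e he hq)
    · exact hP e he
  have key : (LinearEquiv.ofBijective (DirectSum.coeLinearMap gr) h).symm x = 0 := by
    refine DFinsupp.ext fun e => ?_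
    exact Subtype.ext (h0 e)
  simpa using key

end Proj

section Mon
variable {k : Type} [Field k] {n : ℕ} {Δ : SC n}

/-- residue class of a monomial -/
noncomputable def mon (k : Type) [Field k] {n : ℕ} (Δ : SC n) (a : Fin n → ℕ) : SRRing k Δ :=
  Ideal.Quotient.mk (srIdeal k Δ) (monomial (Finsupp.equivFunOnFinite.symm a) (1 : k))

/-- support of an exponent -/
def sp {n : ℕ} (a : Fin n → ℕ) : Finset (Fin n) := Finset.univ.filter fun i => a i ≠ 0

lemma mem_sp {a : Fin n → ℕ} {i : Fin n} : i ∈ sp a ↔ a i ≠ 0 := by simp [sp]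

/-- indicator exponent, as a function -/
def iv {n : ℕ} (σ : Finset (Fin n)) : Fin n → ℕ := fun i => if i ∈ σ then 1 else 0

lemma sp_iv (σ : Finset (Fin n)) : sp (iv σ) = σ := by
  ext i; simp [mem_sp, iv]

lemma sp_add (a b : Fin n → ℕ) : sp (a + b) = sp a ∪ sp b := by
  ext i; simp only [mem_sp, Finset.mem_union, Pi.add_apply]; omega

lemma mon_add (a b : Fin n → ℕ) : mon k Δ (a + b) = mon k Δ a * mon k Δ b := by
  have : Finsupp.equivFunOnFinite.symm (a + b) =
    Finsupp.equivFunOnFinite.symm a + Finsupp.equivFunOnFinite.symm b := by ext; simp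
  rw [mon, mon, mon, ← map_mul, monomial_mul, this, one_mul]

lemma mon_zero : mon k Δ 0 = 1 := by
  have : (Finsupp.equivFunOnFinite.symm (0 : Fin n → ℕ)) = 0 := by ext; simp
  rw [mon, this]; rfl

lemma mon_iv (σ : Finset (Fin n)) :
    mon k Δ (iv σ) = Ideal.Quotient.mk (srIdeal k Δ) (xm k σ) := by
  have : Finsupp.equivFunOnFinite.symm (iv σ) = ind σ := by ext i; simp [iv, ind_apply]
  rw [mon, this, xm_eq]

lemma mon_eq_zero {a : Fin n → ℕ} (h : sp a ∉ Δ.faces) : mon k Δ a = 0 := by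
  rw [mon, Ideal.Quotient.eq_zero_iff_mem, srIdeal_eq, mem_monI (fun σ τ => Δ.down_closed)]
  intro c hc
  replace hc := Finset.mem_singleton.mp (support_monomial_subset hc)
  subst hc
  convert h using 2
  ext i; simp [mem_sp]

lemma mk_eq_sum (s : MvPolynomial (Fin n) k) :
    Ideal.Quotient.mk (srIdeal k Δ) s = ∑ c ∈ s.support, s.coeff c • mon k Δ ⇑c := by
  conv_lhs => rw [s.as_sum]
  rw [map_sum]
  refine Finset.sum_congr rfl fun c _ => ?_
  have h1 : Finsupp.equivFunOnFinite.symm ⇑c = c := by ext; simp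
  have h2 : monomial c (s.coeff c) = s.coeff c • monomial c (1 : k) := by
    rw [smul_monomial, smul_eq_mul, mul_one]
  rw [mon, h1, h2]
  exact map_smul (Ideal.Quotient.mkₐ k (srIdeal k Δ)) _ _

end Mon

end CanonPf

namespace CanonPf
open MvPolynomial

section SetupSec
set_option linter.unusedSectionVars false
variable {k : Type} [Field k] {n : ℕ} {Δ : SC n} {d : ℕ} {ω : Type} [AddCommGroup ω]
  [Module (SRRing k Δ) ω] [Module k ω] [IsScalarTower k (SRRing k Δ) ω]
  {gr : (Fin n → ℕ) → Submodule k ω}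

lemma mk_smul_eq (s : MvPolynomial (Fin n) k) (x : ω) :
    Ideal.Quotient.mk (srIdeal k Δ) s • x = ∑ c ∈ s.support, s.coeff c • (mon k Δ ⇑c • x) := by
  rw [mk_eq_sum, Finset.sum_smul]
  exact Finset.sum_congr rfl fun c _ => smul_assoc _ _ _

lemma smul_mem_of_mon (W : Submodule k ω) (r : SRRing k Δ) {x : ω}
    (h : ∀ c, mon k Δ c • x ∈ W) : r • x ∈ W := by
  obtain ⟨s, rfl⟩ := Ideal.Quotient.mk_surjective r
  rw [mk_smul_eq]
  exact W.sum_mem fun c _ => W.smul_mem _ (h _)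

lemma mon_smul_smul (a b : Fin n → ℕ) (x : ω) :
    mon k Δ a • mon k Δ b • x = mon k Δ (a + b) • x := by
  rw [mon_add, mul_smul]

/-- multiplication is compatible with the grading -/
def MulC (Δ : SC n) [Module (SRRing k Δ) ω] (gr : (Fin n → ℕ) → Submodule k ω) : Prop :=
  ∀ (a b : Fin n → ℕ) (m : ω), m ∈ gr b → mon k Δ a • m ∈ gr (a + b)

lemma mon_smul_Conc (hI : DirectSum.IsInternal gr) (hm : MulC Δ gr) (b : Fin n → ℕ) (x : ω) :
    mon k Δ b • x ∈ Conc hI (fun e => b ≤ e) := by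
  refine gr_induction hI (P := fun x => mon k Δ b • x ∈ Conc hI (fun e => b ≤ e)) ?_ ?_ ?_ x
  · rw [smul_zero]; exact Submodule.zero_mem _
  · intro a x hx
    exact gr_mem_Conc hI (by intro i; simp) (hm b a x hx)
  · intro x y hx hy
    rw [smul_add]; exact Submodule.add_mem _ hx hy

lemma fin_comp (hI : DirectSum.IsInternal gr) (hm : MulC Δ gr)
    (hf : Module.Finite (SRRing k Δ) ω) (a : Fin n → ℕ) : Module.Finite k (gr a) := by
  classical
  obtain ⟨S, hS⟩ := hf.fg_top
  let T : Finset ω := (Finset.Iic a ×ˢ S).image fun p => pr hI a (mon k Δ p.1 • p.2)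
  have key : ∀ x : ω, ∀ r : SRRing k Δ, pr hI a (r • x) ∈ Submodule.span k (T : Set ω) := by
    intro x
    have hx : x ∈ Submodule.span (SRRing k Δ) (S : Set ω) := by rw [hS]; trivial
    induction hx using Submodule.span_induction with
    | mem x hx =>
      intro r
      have : r • x ∈ (Submodule.span k (T : Set ω)).comap (pr hI a) := by
        refine smul_mem_of_mon _ r fun c => ?_
        rw [Submodule.mem_comap]
        by_cases hc : c ≤ a
        · apply Submodule.subset_span
          simp only [T, Finset.coe_image, Set.mem_image]
          exact ⟨(c, x), by simpa using ⟨hc, hx⟩, rfl⟩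
        · rw [mon_smul_Conc hI hm c x a hc]; exact Submodule.zero_mem _
      exact this
    | zero => intro r; rw [smul_zero, map_zero]; exact Submodule.zero_mem _
    | add x y _ _ hx hy =>
      intro r; rw [smul_add, map_add]; exact Submodule.add_mem _ (hx r) (hy r)
    | smul r' x _ hx => intro r; rw [smul_smul]; exact hx _
  have hle : gr a ≤ Submodule.span k (T : Set ω) := by
    intro x hx
    have := key x 1
    rwa [one_smul, pr_same hI hx] at this
  exact Submodule.finiteDimensional_of_le hle

/-- the abstract properties used in the final argument -/
structure Setup (Δ : SC n) (d : ℕ) [Module (SRRing k Δ) ω]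
    (gr : (Fin n → ℕ) → Submodule k ω) : Prop where
  int : DirectSum.IsInternal gr
  mul : MulC Δ gr
  T : ∀ m : ω, (∀ F, Δ.IsFacet F → mon k Δ (iv F) • m = 0) → m = 0
  C : ∀ G u v, Ridge Δ G u v → G.card = d → ∃ w : ω, ∀ m : ω, ∃ s : MvPolynomial (Fin n) k,
    mon k Δ (iv G) • m = Ideal.Quotient.mk (srIdeal k Δ) s • w
  nz : ∀ a, sp a ∉ Δ.faces → gr a = ⊥
  one : ∀ a, ∀ m ∈ gr a, m ≠ 0 → ∀ x ∈ gr a, ∃ c : k, x = c • m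
  fac : ∀ F, Δ.IsFacet F → gr (iv F) ≠ ⊥
  fcard : ∀ F ∈ Δ.faces, F.card = d + 1 → Δ.IsFacet F
  strong : ∀ σ F F', Δ.IsFacet F → Δ.IsFacet F' → σ ⊆ F → σ ⊆ F' →
    Relation.ReflTransGen (Step Δ d σ) F F'

lemma Setup.face (H : Setup Δ d gr) {a : Fin n → ℕ} {m : ω} (hm : m ∈ gr a) (h0 : m ≠ 0) :
    sp a ∈ Δ.faces := by
  by_contra h
  rw [H.nz a h, Submodule.mem_bot] at hm
  exact h0 hm

lemma Setup.sub (H : Setup Δ d gr) {a : Fin n → ℕ} {m : ω} (hm : m ∈ gr a) {F : Finset (Fin n)}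
    (hF : Δ.IsFacet F) (h0 : mon k Δ (iv F) • m ≠ 0) : sp a ⊆ F := by
  have h := H.face (H.mul _ _ _ hm) h0
  rw [sp_add, sp_iv] at h
  rw [hF.2 _ h Finset.subset_union_left]
  exact Finset.subset_union_right

lemma Setup.L1 (H : Setup Δ d gr) {e : Fin n → ℕ} {y : ω} (hy : y ∈ gr e)
    (hF : Δ.IsFacet (sp e)) (h0 : y ≠ 0) : mon k Δ (iv (sp e)) • y ≠ 0 := by
  intro h
  apply h0
  refine H.T y fun F' hF' => ?_
  by_contra hne
  have := H.sub hy hF' hne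
  have := hF.2 _ hF'.1 this
  rw [← this] at hne
  exact hne h

lemma Setup.L1' (H : Setup Δ d gr) (N : ℕ) : ∀ {e : Fin n → ℕ} {y : ω}, y ∈ gr e →
    Δ.IsFacet (sp e) → y ≠ 0 → mon k Δ (N • iv (sp e)) • y ≠ 0 := by
  induction N with
  | zero => intro e y _ _ h0; rw [zero_smul, mon_zero, one_smul]; exact h0
  | succ N ih =>
    intro e y hy hF h0
    have h1 := H.L1 hy hF h0
    have hs : sp (iv (sp e) + e) = sp e := by rw [sp_add, sp_iv, Finset.union_self]
    have h2 := ih (H.mul (iv (sp e)) e y hy) (by rw [hs]; exact hF) h1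
    rw [hs, mon_smul_smul] at h2
    rwa [succ_nsmul]

lemma Setup.L3 (H : Setup Δ d gr) {a b : Fin n → ℕ} {m : ω} (hm : m ∈ gr a)
    {F : Finset (Fin n)} (hF : Δ.IsFacet F) (h0 : mon k Δ (iv F) • m ≠ 0) (hb : sp b ⊆ F) :
    mon k Δ b • m ≠ 0 := by
  intro h
  have hs : sp (iv F + a) = F := by
    rw [sp_add, sp_iv]; exact Finset.union_eq_left.mpr (H.sub hm hF h0)
  have h1 := H.L1' (∑ i, b i) (H.mul _ _ _ hm) (by rw [hs]; exact hF) h0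
  rw [hs, mon_smul_smul] at h1
  have hle : b ≤ (∑ i, b i) • iv F := by
    intro i
    by_cases hi : b i = 0
    · simp [hi]
    · have : i ∈ F := hb (mem_sp.mpr hi)
      simp only [Pi.smul_apply, iv, this, if_true, smul_eq_mul, mul_one]
      exact Finset.single_le_sum (f := b) (fun _ _ => Nat.zero_le _) (Finset.mem_univ i)
  apply h1
  have e : (∑ i, b i) • iv F + iv F = (((∑ i, b i) • iv F - b) + iv F) + b := by
    ext i
    have := hle i
    simp only [Pi.add_apply, Pi.sub_apply, Pi.smul_apply] at this ⊢
    omega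
  rw [e, ← mon_smul_smul, h, smul_zero]

lemma iv_insert {G : Finset (Fin n)} {v : Fin n} (hv : v ∉ G) {c : Fin n → ℕ} (hc : c v ≠ 0) :
    ∃ c', c + iv G = c' + iv (insert v G) := by
  refine ⟨c - Pi.single v 1, ?_⟩
  ext i
  by_cases hi : i = v
  · subst hi
    simp [iv, hv]; omega
  · simp [iv, hi]

lemma Setup.cross (H : Setup Δ d gr) {a : Fin n → ℕ} {m : ω} (hm : m ∈ gr a)
    {G : Finset (Fin n)} {u v : Fin n} (hG : Ridge Δ G u v) (hc : G.card = d) (ha : sp a ⊆ G)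
    (hu : mon k Δ (iv (insert u G)) • m ≠ 0) : mon k Δ (iv (insert v G)) • m ≠ 0 := by
  intro hv
  have hFu : Δ.IsFacet (insert u G) :=
    H.fcard _ hG.fu (by rw [Finset.card_insert_of_notMem hG.hu, hc])
  have hFv : Δ.IsFacet (insert v G) :=
    H.fcard _ hG.fv (by rw [Finset.card_insert_of_notMem hG.hv, hc])
  obtain ⟨y, hy, hy0⟩ := Submodule.exists_mem_ne_zero_of_ne_bot (H.fac _ hFv)
  have hy1 : mon k Δ (iv (insert v G)) • y ≠ 0 := by
    have := H.L1 hy (by rw [sp_iv]; exact hFv) hy0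
    rwa [sp_iv] at this
  obtain ⟨w, hw⟩ := H.C G u v hG hc
  obtain ⟨s, hs⟩ := hw m
  obtain ⟨t, ht⟩ := hw y
  have hau : a u = 0 := by
    by_contra h; exact hG.hu (ha (mem_sp.mpr h))
  have hav : a v = 0 := by
    by_contra h; exact hG.hv (ha (mem_sp.mpr h))
  have comm : Ideal.Quotient.mk (srIdeal k Δ) t • mon k Δ (iv G) • m =
      Ideal.Quotient.mk (srIdeal k Δ) s • mon k Δ (iv G) • y := by
    rw [hs, ht, smul_smul, smul_smul, mul_comm]
  have h1 : Ideal.Quotient.mk (srIdeal k Δ) t • mon k Δ (iv G) • m ∈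
      Conc H.int (fun e => e v = 0) := by
    refine smul_mem_of_mon _ _ fun c => ?_
    rw [mon_smul_smul]
    by_cases hcv : c v = 0
    · refine gr_mem_Conc H.int ?_ (H.mul _ _ _ hm)
      simp [hcv, hav, iv, hG.hv]
    · obtain ⟨c', hc'⟩ := iv_insert hG.hv hcv
      rw [hc', ← mon_smul_smul, hv, smul_zero]
      exact Submodule.zero_mem _
  have h2 : Ideal.Quotient.mk (srIdeal k Δ) s • mon k Δ (iv G) • y ∈
      Conc H.int (fun e => 1 ≤ e v) := by
    refine smul_mem_of_mon _ _ fun c => ?_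
    rw [mon_smul_smul]
    refine gr_mem_Conc H.int ?_ (H.mul _ _ _ hy)
    simp [iv]
  have h3 : Ideal.Quotient.mk (srIdeal k Δ) s • mon k Δ (iv G) • y = 0 :=
    Conc_disj H.int (by intro e h h'; omega) (comm ▸ h1) h2
  have h4 : ∀ c ∈ s.support, mon k Δ (⇑c + iv G) • y = 0 := by
    intro c hcs
    have := congrArg (pr H.int (⇑c + iv G + iv (insert v G))) h3
    rw [mk_smul_eq, map_sum, map_zero, Finset.sum_eq_single c, mon_smul_smul, map_smul,
      pr_same H.int (H.mul _ _ _ hy)] at this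
    · exact (smul_eq_zero.mp this).resolve_left (mem_support_iff.mp hcs)
    · intro c' _ hne
      rw [mon_smul_smul, map_smul, pr_ne H.int ?_ (H.mul _ _ _ hy), smul_zero]
      intro h
      apply hne
      exact DFunLike.coe_injective (add_right_cancel (add_right_cancel h))
    · intro h; exact absurd hcs h
  have h5 : mon k Δ (iv G) • mon k Δ (iv G) • m ∈ Conc H.int (fun e => 1 ≤ e u) := by
    rw [hs, smul_smul, mul_comm, ← smul_smul, mk_smul_eq]
    refine Submodule.sum_mem _ fun c hcs => Submodule.smul_mem _ _ ?_
    rw [mon_smul_smul]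
    have h6 : ¬ sp (⇑c + iv G) ⊆ insert v G := fun h6 => H.L3 hy hFv hy1 h6 (h4 c hcs)
    obtain ⟨j, hj, hj'⟩ := Finset.not_subset.mp h6
    rw [Finset.mem_insert, not_or] at hj'
    by_cases hju : j = u
    · subst hju
      intro e he
      refine mon_smul_Conc H.int H.mul _ w e fun hle => he ?_
      exact (Nat.one_le_iff_ne_zero.mpr (mem_sp.mp hj)).trans (hle j)
    · have hnf : sp (⇑c + iv G) ∉ Δ.faces := by
        intro hf
        refine hG.only j hj'.2 hju hj'.1 (Δ.down_closed hf ?_)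
        refine Finset.insert_subset hj ?_
        rw [sp_add, sp_iv]; exact Finset.subset_union_right
      have hz : mon k Δ (⇑c + iv G) • w = 0 := by
        rw [mon_eq_zero hnf]; exact zero_smul (SRRing k Δ) w
      rw [hz]
      exact Submodule.zero_mem _
  rw [mon_smul_smul] at h5
  refine H.L3 hm hFu hu (b := iv G + iv G) ?_ (gr_Conc_zero H.int ?_ (H.mul _ _ _ hm) h5)
  · rw [sp_add, sp_iv, Finset.union_self]; exact Finset.subset_insert _ _
  · simp [iv, hG.hu, hau]

lemma Setup.A (H : Setup Δ d gr) {a b : Fin n → ℕ} {m : ω} (hm : m ∈ gr a) (h0 : m ≠ 0)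
    (hf : sp a ∪ sp b ∈ Δ.faces) : mon k Δ b • m ≠ 0 := by
  have : ∃ F, Δ.IsFacet F ∧ mon k Δ (iv F) • m ≠ 0 := by
    by_contra hcon
    push Not at hcon
    exact h0 (H.T m hcon)
  obtain ⟨F, hF, hF0⟩ := this
  obtain ⟨F', hF', hs⟩ := exists_facet hf
  have hch := H.strong (sp a) F F' hF hF' (H.sub hm hF hF0)
    (Finset.subset_union_left.trans hs)
  have key : mon k Δ (iv F') • m ≠ 0 := by
    clear hs hF'
    induction hch with
    | refl => exact hF0
    | tail _ hst ih =>
      obtain ⟨G, u, v, hr, hsub, hc, rfl, rfl⟩ := hst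
      exact H.cross hm hr hc hsub ih
  exact H.L3 hm hF' key (Finset.subset_union_right.trans hs)

lemma Setup.gen (H : Setup Δ d gr) {a b : Fin n → ℕ} (hba : b ≤ a) (hb : gr b ≠ ⊥)
    {x : ω} (hx : x ∈ gr a) : x ∈ Submodule.span (SRRing k Δ) (gr b : Set ω) := by
  by_cases hx0 : x = 0
  · subst hx0; exact Submodule.zero_mem _
  obtain ⟨m, hm, hm0⟩ := Submodule.exists_mem_ne_zero_of_ne_bot hb
  have e : (a - b) + b = a := tsub_add_cancel_of_le hba
  have h1 : mon k Δ (a - b) • m ≠ 0 := by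
    refine H.A hm hm0 (Δ.down_closed (H.face hx hx0) ?_)
    refine Finset.union_subset ?_ ?_ <;> intro i hi <;> rw [mem_sp] at hi ⊢
    · have : b i ≤ a i := hba i
      omega
    · simp only [Pi.sub_apply] at hi; omega
  have h2 := H.mul (a - b) b m hm
  rw [e] at h2
  obtain ⟨c, rfl⟩ := H.one a _ h2 h1 x hx
  rw [← smul_assoc]
  exact Submodule.smul_mem _ _ (Submodule.subset_span hm)

lemma Setup.gen_top (H : Setup Δ d gr) (B : Set (Fin n → ℕ))
    (hB : ∀ a, gr a ≠ ⊥ → ∃ b ∈ B, b ≤ a ∧ gr b ≠ ⊥) :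
    Submodule.span (SRRing k Δ) (⋃ a ∈ B, (gr a : Set ω)) = ⊤ := by
  rw [eq_top_iff]
  rintro x -
  refine gr_induction H.int
    (P := fun x => x ∈ Submodule.span (SRRing k Δ) (⋃ a ∈ B, (gr a : Set ω)))
    (Submodule.zero_mem _) ?_ (fun _ _ => Submodule.add_mem _) x
  intro a x hx
  by_cases ha : gr a = ⊥
  · rw [ha, Submodule.mem_bot] at hx; subst hx; exact Submodule.zero_mem _
  obtain ⟨b, hbB, hba, hb⟩ := hB a ha
  refine Submodule.span_mono ?_ (H.gen hba hb hx)
  exact Set.subset_biUnion_of_mem (u := fun a => (gr a : Set ω)) hbB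

lemma Setup.min_top (H : Setup Δ d gr) :
    Submodule.span (SRRing k Δ)
        (⋃ a ∈ {a : Fin n → ℕ | gr a ≠ ⊥ ∧
            ∀ b : Fin n → ℕ, gr b ≠ ⊥ → (∀ i, b i ≤ a i) → b = a},
          (gr a : Set ω)) = ⊤ := by
  refine H.gen_top _ ?_
  intro a
  induction a using WellFoundedLT.induction with
  | ind a ih =>
  intro ha
  by_cases hmin : ∀ b : Fin n → ℕ, gr b ≠ ⊥ → (∀ i, b i ≤ a i) → b = a
  · exact ⟨a, ⟨ha, hmin⟩, le_refl _, ha⟩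
  · push Not at hmin
    obtain ⟨b, hb, hle, hne⟩ := hmin
    obtain ⟨c, hc, hcb, hc0⟩ := ih b (lt_of_le_of_ne hle hne) hb
    exact ⟨c, hc, hcb.trans hle, hc0⟩

lemma Setup.zero_top (H : Setup Δ d gr) (h0 : gr 0 ≠ ⊥) :
    Submodule.span (SRRing k Δ) (gr 0 : Set ω) = ⊤ := by
  have := H.gen_top {0} (fun a _ => ⟨0, rfl, fun i => Nat.zero_le _, h0⟩)
  simpa using this

lemma Setup.iso (H : Setup Δ d gr) (h0 : gr 0 ≠ ⊥) :
    Nonempty (ω ≃ₗ[SRRing k Δ] SRRing k Δ) := by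
  obtain ⟨m, hm, hm0⟩ := Submodule.exists_mem_ne_zero_of_ne_bot h0
  have hinj : Function.Injective (LinearMap.toSpanSingleton (SRRing k Δ) ω m) := by
    rw [← LinearMap.ker_eq_bot, LinearMap.ker_eq_bot']
    intro r hr
    obtain ⟨s, rfl⟩ := Ideal.Quotient.mk_surjective r
    rw [LinearMap.toSpanSingleton_apply] at hr
    rw [Ideal.Quotient.eq_zero_iff_mem, srIdeal_eq, mem_monI (fun σ τ => Δ.down_closed)]
    intro c hcs hcf
    have := congrArg (pr H.int (⇑c + 0)) hr
    rw [mk_smul_eq, map_sum, map_zero, Finset.sum_eq_single c, map_smul,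
      pr_same H.int (H.mul _ _ _ hm)] at this
    · have h2 := (smul_eq_zero.mp this).resolve_left (mem_support_iff.mp hcs)
      refine H.A hm hm0 (Δ.down_closed hcf ?_) h2
      refine Finset.union_subset ?_ ?_ <;> intro i hi <;> rw [mem_sp] at hi
      · simp at hi
      · rwa [Finsupp.mem_support_iff]
    · intro c' _ hne
      rw [map_smul, pr_ne H.int ?_ (H.mul _ _ _ hm), smul_zero]
      intro h
      exact hne (DFunLike.coe_injective (add_right_cancel h))
    · intro h; exact absurd hcs h
  have hsurj : Function.Surjective (LinearMap.toSpanSingleton (SRRing k Δ) ω m) := by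
    rw [← LinearMap.range_eq_top, LinearMap.range_toSpanSingleton, eq_top_iff,
      ← H.zero_top h0, Submodule.span_le]
    intro x hx
    obtain ⟨c, rfl⟩ := H.one 0 m hm hm0 x hx
    rw [SetLike.mem_coe, Submodule.mem_span_singleton]
    exact ⟨c • 1, by rw [smul_assoc, one_smul]⟩
  exact ⟨(LinearEquiv.ofBijective _ ⟨hinj, hsurj⟩).symm⟩

/-- if the module is generated by parts of nonzero degree then the degree zero part vanishes -/
lemma Setup.conc_gen (H : Setup Δ d gr) (B : Set (Fin n → ℕ)) (P : (Fin n → ℕ) → Prop)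
    (hP : ∀ b ∈ B, ∀ c, P (c + b))
    (h : Submodule.span (SRRing k Δ) (⋃ a ∈ B, (gr a : Set ω)) = ⊤) (x : ω) :
    x ∈ Conc H.int P := by
  have key : ∀ x : ω, ∀ r : SRRing k Δ, r • x ∈ Conc H.int P := by
    intro x
    have hx : x ∈ Submodule.span (SRRing k Δ) (⋃ a ∈ B, (gr a : Set ω)) := by rw [h]; trivial
    induction hx using Submodule.span_induction with
    | mem x hx =>
      intro r
      simp only [Set.mem_iUnion] at hx
      obtain ⟨b, hb, hx⟩ := hx
      exact smul_mem_of_mon _ r fun c => gr_mem_Conc H.int (hP b hb c) (H.mul c b x hx)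
    | zero => intro r; rw [smul_zero]; exact Submodule.zero_mem _
    | add x y _ _ hx hy => intro r; rw [smul_add]; exact Submodule.add_mem _ (hx r) (hy r)
    | smul r' x _ hx => intro r; rw [smul_smul]; exact hx _
  simpa using key x 1

end SetupSec

end CanonPf

namespace CanonPf
open MvPolynomial

section Final
variable {k : Type} [Field k] {n : ℕ} {Δ : SC n} {d : ℕ} {ω : Type} [AddCommGroup ω]
  [Module (SRRing k Δ) ω] [Module k ω] [IsScalarTower k (SRRing k Δ) ω]
  {gr : (Fin n → ℕ) → Submodule k ω}

lemma gr_finrank (hd : Δ.dim = (d : ℤ)) (hgr : IsCanonicallyMultiGraded k Δ ω gr)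
    (a : Fin n → ℕ) :
    Module.finrank k (gr a) = Module.finrank k (Δ.relHomology k (sp a) d) := by
  have h := hgr.2.2 a
  rw [sup_eq hd] at h
  exact h

lemma mulC_of (hgr : IsCanonicallyMultiGraded k Δ ω gr) : MulC Δ gr :=
  fun a b m hm => hgr.2.1 a b _ m (Submodule.subset_span rfl) hm

lemma gr_ne_bot_iff (hd : Δ.dim = (d : ℤ)) (hω : IsCanonicalModuleQ k (srIdeal k Δ) ω)
    (hgr : IsCanonicallyMultiGraded k Δ ω gr) (a : Fin n → ℕ) :
    gr a ≠ ⊥ ↔ Module.finrank k (Δ.relHomology k (sp a) d) ≠ 0 := by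
  have := fin_comp hgr.1 (mulC_of hgr) hω.1 a
  rw [← gr_finrank hd hgr, Ne, Ne, Submodule.finrank_eq_zero]

lemma mkSetup (hd : Δ.dim = (d : ℤ)) (hpm : Δ.IsPseudomanifold) (hnorm : Δ.Normal)
    (hω : IsCanonicalModuleQ k (srIdeal k Δ) ω) (hgr : IsCanonicallyMultiGraded k Δ ω gr) :
    Setup Δ d gr := by
  obtain ⟨c, hn⟩ := exists_codim hd hpm
  have hr : ∀ σ ∈ Δ.faces, σ.card ≤ d + 1 := fun σ hσ => card_le hd hσ
  refine ⟨hgr.1, mulC_of hgr, ?_, ?_, ?_, ?_, ?_, ?_, ?_⟩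
  · intro m hm
    refine canon_T Δ hω hn hr (exists_top hd) m ?_
    intro F hF hc
    rw [← mon_iv]
    exact hm F (facet_of_card hd hF hc)
  · intro G u v hG hc
    obtain ⟨w, hw⟩ := canon_C Δ hω hn hr (exists_top hd) hG (by rw [hc])
    refine ⟨w, fun m => ?_⟩
    obtain ⟨s, hs⟩ := hw m
    exact ⟨s, by rw [mon_iv]; exact hs⟩
  · intro a ha
    by_contra h
    exact (gr_ne_bot_iff hd hω hgr a).mp h (h_nonface hd ha)
  · intro a m hm h0 x hx
    have := fin_comp hgr.1 (mulC_of hgr) hω.1 a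
    have hne : gr a ≠ ⊥ := by
      intro h; rw [h, Submodule.mem_bot] at hm; exact h0 hm
    have hf := (gr_ne_bot_iff hd hω hgr a).mp hne
    have hface : sp a ∈ Δ.faces := by
      by_contra h; exact hf (h_nonface hd h)
    have h1 : Module.finrank k (gr a) = 1 := by
      have := h_le_one (k := k) hd hpm hnorm hface
      rw [gr_finrank hd hgr]; omega
    have hm0 : (⟨m, hm⟩ : gr a) ≠ 0 := by
      intro h; exact h0 (congrArg Subtype.val h)
    obtain ⟨c, hc⟩ := (finrank_eq_one_iff_of_nonzero' _ hm0).mp h1 ⟨x, hx⟩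
    exact ⟨c, (congrArg Subtype.val hc).symm⟩
  · intro F hF
    rw [gr_ne_bot_iff hd hω hgr, sp_iv]
    exact h_facet hd hpm hF
  · intro F hF hc
    exact facet_of_card hd hF hc
  · intro σ F F' hF hF' h h'
    exact strong' hd hpm hnorm hF hF' h h'

lemma sp_zero : sp (0 : Fin n → ℕ) = ∅ := by
  ext i; simp [mem_sp]

lemma two_ne (h : ringChar k ≠ 2) : (2 : k) ≠ 0 := by
  intro h2
  have h3 : ringChar k ∣ 2 := ringChar.dvd (by exact_mod_cast h2)
  rcases (Nat.dvd_prime Nat.prime_two).mp h3 with h1 | h1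
  · exact CharP.ringChar_ne_one h1
  · exact h h1

theorem main (hd : Δ.dim = (d : ℤ))
    (hpm : Δ.IsPseudomanifold) (hnorm : Δ.Normal)
    (hω : IsCanonicalModuleQ k (srIdeal k Δ) ω)
    (hgr : IsCanonicallyMultiGraded k Δ ω gr) :
    (Submodule.span (SRRing k Δ)
        (⋃ a ∈ {a : Fin n → ℕ | gr a ≠ ⊥ ∧
            ∀ b : Fin n → ℕ, gr b ≠ ⊥ → (∀ i, b i ≤ a i) → b = a},
          (gr a : Set ω)) = ⊤) ∧
    (ringChar k = 2 →
      Submodule.span (SRRing k Δ) (gr 0 : Set ω) = ⊤ ∧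
        Nonempty (ω ≃ₗ[SRRing k Δ] SRRing k Δ)) ∧
    (ringChar k ≠ 2 → Δ.IsHomologyManifold k →
      (Δ.Orientable ℤ ↔
        (Submodule.span (SRRing k Δ) (gr 0 : Set ω) = ⊤ ∧
          Nonempty (ω ≃ₗ[SRRing k Δ] SRRing k Δ))) ∧
      (¬ Δ.Orientable ℤ ↔
        Submodule.span (SRRing k Δ)
          (⋃ a ∈ {a : Fin n → ℕ | ∑ i, a i = 1}, (gr a : Set ω)) = ⊤)) := by
  have H := mkSetup hd hpm hnorm hω hgr
  refine ⟨H.min_top, ?_, ?_⟩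
  · intro h2
    have h2' : (2 : k) = 0 := by
      have := ringChar.Nat.cast_ringChar (R := k)
      rw [h2] at this; exact_mod_cast this
    have h0 : gr 0 ≠ ⊥ := by
      rw [gr_ne_bot_iff hd hω hgr, sp_zero]
      exact h_char2 hd hpm h2' Δ.empty_mem
    exact ⟨H.zero_top h0, H.iso h0⟩
  · intro h2 hm
    have hor : Δ.Orientable ℤ ↔ gr 0 ≠ ⊥ := by
      rw [gr_ne_bot_iff hd hω hgr, sp_zero]
      exact orientable_iff (two_ne h2) hd hpm hnorm hm.1
    constructor
    · rw [hor]
      refine ⟨fun h0 => ⟨H.zero_top h0, H.iso h0⟩, fun h => ?_⟩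
      intro h0
      obtain ⟨F, hF, hc⟩ := exists_top hd
      apply H.fac F (facet_of_card hd hF hc)
      have ht := h.1
      rw [h0] at ht
      have hz : ∀ x : ω, x = 0 := by
        intro x
        have hx : x ∈ (⊤ : Submodule (SRRing k Δ) ω) := trivial
        rw [← ht] at hx
        simpa using hx
      rw [eq_bot_iff]
      intro x _
      exact (Submodule.mem_bot k).mpr (hz x)
    · rw [hor, not_not]
      constructor
      · intro h0
        refine H.gen_top _ ?_
        intro a ha
        have hne : a ≠ 0 := by rintro rfl; exact ha h0
        obtain ⟨i, hi⟩ := Function.ne_iff.mp hne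
        obtain ⟨m, hm', hm0⟩ := Submodule.exists_mem_ne_zero_of_ne_bot ha
        have hf := H.face hm' hm0
        refine ⟨iv {i}, ?_, ?_, ?_⟩
        · simp [iv]
        · intro j
          by_cases hj : j = i
          · subst hj
            simp only [iv, Finset.mem_singleton, if_true]
            exact Nat.one_le_iff_ne_zero.mpr hi
          · simp [iv, hj]
        · rw [gr_ne_bot_iff hd hω hgr, sp_iv]
          refine h_manifold hd hpm hm ?_ (Finset.singleton_ne_empty i)
          exact Δ.down_closed hf (Finset.singleton_subset_iff.mpr (mem_sp.mpr hi))
      · intro h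
        rw [eq_bot_iff]
        intro x hx
        have := H.conc_gen _ (fun e => e ≠ 0) ?_ h x
        · exact (Submodule.mem_bot k).mpr (gr_Conc_zero H.int (by simp) hx this)
        · intro b hb c hcb
          have hb' : ∑ i, b i = 1 := hb
          have : ∀ i, b i = 0 := by
            intro i
            have := congrFun hcb i
            simp only [Pi.add_apply, Pi.zero_apply] at this
            omega
          simp [this] at hb'

end Final

end CanonPf

set_option maxHeartbeats 1000000 in
set_option synthInstance.maxHeartbeats 1000000 in
/-- Let `Δ` be a `d`-dimensional normal pseudomanifold and `R = k[Δ]`.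
Then `ω_R` is generated by its components of componentwise-minimal `ℤ^n`-degrees.  In
particular, in characteristic `2`, `ω_R = R·[ω_R]_0 ≅ R`.  Moreover, if `char k ≠ 2` and `Δ`
is a `k`-homology manifold, then `Δ` is orientable iff `ω_R = R·[ω_R]_0 ≅ R`, and `Δ` is
non-orientable iff `ω_R = R·[ω_R]_1`. -/
theorem canonicalModule_of_normal_pseudomanifold
    (k : Type) [Field k] {n : ℕ} (Δ : SC n) (d : ℕ) (hd : Δ.dim = (d : ℤ))
    (hpm : Δ.IsPseudomanifold) (hnorm : Δ.Normal)
    (ω : Type) [AddCommGroup ω] [Module (SRRing k Δ) ω] [Module k ω]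
    [IsScalarTower k (SRRing k Δ) ω]
    (hω : IsCanonicalModuleQ k (srIdeal k Δ) ω)
    (grN : (Fin n → ℕ) → Submodule k ω) (hgrN : IsCanonicallyMultiGraded k Δ ω grN) :
    (Submodule.span (SRRing k Δ)
        (⋃ a ∈ {a : Fin n → ℕ | grN a ≠ ⊥ ∧
            ∀ b : Fin n → ℕ, grN b ≠ ⊥ → (∀ i, b i ≤ a i) → b = a},
          (grN a : Set ω)) = ⊤) ∧
    (ringChar k = 2 →
      Submodule.span (SRRing k Δ) (grN 0 : Set ω) = ⊤ ∧
        Nonempty (ω ≃ₗ[SRRing k Δ] SRRing k Δ)) ∧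
    (ringChar k ≠ 2 → Δ.IsHomologyManifold k →
      (Δ.Orientable ℤ ↔
        (Submodule.span (SRRing k Δ) (grN 0 : Set ω) = ⊤ ∧
          Nonempty (ω ≃ₗ[SRRing k Δ] SRRing k Δ))) ∧
      (¬ Δ.Orientable ℤ ↔
        Submodule.span (SRRing k Δ)
          (⋃ a ∈ {a : Fin n → ℕ | ∑ i, a i = 1}, (grN a : Set ω)) = ⊤)) := by
  exact CanonPf.main hd hpm hnorm hω hgrN
end
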